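/- arXiv:0909.0340 — 2 statements merged into one kernel-verified Lean document; each statement's English description precedes it below -/
import Mathlib

section
/- Let Λ ⊂ ℝⁿ be a rank-n lattice and for t > 0 let T_{2m}(t,·) ∈ A_{2m} be the degree-2m homogeneous term of the Taylor expansion of x ↦ f_Λ(t,x) at x = 0, and let f^harm_{Λ,m}(t) := P_harm(T_{2m}(t,·)) be its orthogonal projection onto Harm_{2m}. Then for any orthonormal basis B of A_{2m} with respect to the differential pairing, f^harm_{Λ,m}(t) = Σ_{g∈B} [ Σ_{k=0}^m p_{k,2m} (−1)^k ( g(∂/∂x₁,…,∂/∂xₙ) ( r^{2k} · ∂^k f_Λ/∂t^k ) )(t,0) ] · g, where p_{k,2m} := 1/(2^k · k! · Π_{l=0}^{k−1}(n+4m−4−2l)). -/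
noncomputable section

open MvPolynomial MeasureTheory Finset
open scoped RealInnerProductSpace Manifold

namespace Heat

abbrev Poly (n : ℕ) := MvPolynomial (Fin n) ℝ
abbrev E (n : ℕ) := EuclideanSpace ℝ (Fin n)

variable (n : ℕ)

/-- The differential operator `∂^I` on polynomials. -/
def pdI (I : Fin n →₀ ℕ) : Poly n → Poly n :=
  (List.ofFn fun i : Fin n => (fun p : Poly n => (⇑(pderiv i))^[I i] p)).foldr (· ∘ ·) id

/-- The differential pairing `⟨g, f⟩ = (g(∂)f)(0)`. -/
def dPair (g f : Poly n) : ℝ :=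
  eval 0 (∑ I ∈ g.support, g.coeff I • pdI n I f)

/-- The Laplacian `Δ = -∑ ∂ᵢ²` as a linear map on polynomials. -/
def lap : Poly n →ₗ[ℝ] Poly n :=
  -∑ i : Fin n, ((pderiv i : Derivation ℝ (Poly n) (Poly n)).toLinearMap ∘ₗ
    (pderiv i : Derivation ℝ (Poly n) (Poly n)).toLinearMap)

/-- `r² = ∑ xᵢ²`. -/
def rsq : Poly n := ∑ i : Fin n, X i ^ 2

/-- Harmonic homogeneous polynomials of degree `m`. -/
def Harm (m : ℕ) : Submodule ℝ (Poly n) :=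
  homogeneousSubmodule (Fin n) ℝ m ⊓ LinearMap.ker (lap n)

/-- `B` is an orthonormal basis of the subspace `S` w.r.t. the differential pairing. -/
structure IsONBasis (S : Submodule ℝ (Poly n)) (B : Finset (Poly n)) : Prop where
  mem : ∀ h ∈ B, h ∈ S
  ortho : ∀ h ∈ B, ∀ g ∈ B, dPair n h g = if h = g then 1 else 0
  span : Submodule.span ℝ (B : Set (Poly n)) = S

/-- Evaluation of a polynomial at a point of Euclidean space. -/
def peval (f : Poly n) (x : E n) : ℝ := eval (fun i => x i) f

/-- `μ` is the rotation-invariant probability measure on the unit sphere `S^{n-1}`. -/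
structure IsSphereMeasure (μ : Measure (E n)) : Prop where
  prob : IsProbabilityMeasure μ
  supp : μ (Metric.sphere (0 : E n) 1)ᶜ = 0
  inv : ∀ φ : E n ≃ₗᵢ[ℝ] E n, Measure.map φ μ = μ

/-- The lattice spanned (over `ℤ`) by the vectors `b`. -/
def latticeOf (b : Fin n → E n) : Submodule ℤ (E n) := Submodule.span ℤ (Set.range b)

/-- An integral lattice: all square norms are integers. -/
def IsIntegral (L : Submodule ℤ (E n)) : Prop := ∀ v ∈ L, ∃ z : ℤ, ‖v‖ ^ 2 = (z : ℝ)

/-- The matrix `A` with `½A` the Gram matrix of the basis `b`. -/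
def evenGram (b : Fin n → E n) : Matrix (Fin n) (Fin n) ℝ :=
  Matrix.of fun i j => 2 * ⟪b i, b j⟫

/-- A real matrix has integer entries and even diagonal. -/
def IntEvenDiag (M : Matrix (Fin n) (Fin n) ℝ) : Prop :=
  (∀ i j, ∃ z : ℤ, M i j = (z : ℝ)) ∧ ∀ i, ∃ z : ℤ, M i i = 2 * (z : ℝ)

/-- `N` is the level of the lattice with basis `b`. -/
def IsLevel (b : Fin n → E n) (N : ℕ) : Prop :=
  0 < N ∧ IntEvenDiag n ((N : ℝ) • (evenGram n b)⁻¹) ∧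
    ∀ M : ℕ, 0 < M → IntEvenDiag n ((M : ℝ) • (evenGram n b)⁻¹) → N ≤ M

/-- The spherical theta function `Θ_{h,Λ}`. -/
def theta (h : Poly n) (L : Submodule ℤ (E n)) (τ : UpperHalfPlane) : ℂ :=
  ∑' v : L, (peval n h (v : E n) : ℂ) *
    Complex.exp (2 * (Real.pi : ℂ) * Complex.I * ((‖(v : E n)‖ ^ 2 : ℝ) : ℂ) * (τ : ℂ))

/-- The image of the lattice `L` under an isometry of Euclidean space. -/
def mapLat (φ : E n ≃ₗᵢ[ℝ] E n) (L : Submodule ℤ (E n)) : Submodule ℤ (E n) :=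
  L.map (φ.toLinearEquiv.toLinearMap.restrictScalars ℤ)

/-- The Kronecker symbol at 2, `(a/2)`. -/
def kronAtTwo (a : ℤ) : ℤ :=
  if a % 2 = 0 then 0 else if a % 8 = 1 ∨ a % 8 = 7 then 1 else -1

/-- The Kronecker symbol `(a/m)`. -/
def kronSym (a m : ℤ) : ℤ :=
  if m = 0 then (if a = 1 ∨ a = -1 then 1 else 0)
  else
    (if m < 0 ∧ a < 0 then -1 else 1) *
      kronAtTwo a ^ (m.natAbs.factorization 2) *
      jacobiSym a (m.natAbs / 2 ^ (m.natAbs.factorization 2))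

open UpperHalfPlane in
/-- `f` is a modular form of weight `w`, level `N` and character `χ`:  it is holomorphic
on the upper half plane, transforms under `Γ₀(N)` with automorphy factor `χ(d)(cτ+d)^w`,
and is bounded towards all cusps. -/
structure IsModularForm (N : ℕ) (w : ℝ) (χ : ℤ → ℤ) (f : UpperHalfPlane → ℂ) : Prop where
  holo : MDifferentiable 𝓘(ℂ) 𝓘(ℂ) f
  transf : ∀ γ : Matrix.SpecialLinearGroup (Fin 2) ℤ, γ ∈ CongruenceSubgroup.Gamma0 N →
    ∀ τ : UpperHalfPlane, f (γ • τ) =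
      ((χ ((γ : Matrix (Fin 2) (Fin 2) ℤ) 1 1) : ℝ) : ℂ) *
      (((((γ : Matrix (Fin 2) (Fin 2) ℤ) 1 0 : ℤ) : ℂ)) * (τ : ℂ) +
        (((γ : Matrix (Fin 2) (Fin 2) ℤ) 1 1 : ℤ) : ℂ)) ^ (w : ℂ) * f τ
  bdd : ∀ γ : Matrix.SpecialLinearGroup (Fin 2) ℤ,
    IsBoundedAtImInfty fun τ : UpperHalfPlane =>
      (((((γ : Matrix (Fin 2) (Fin 2) ℤ) 1 0 : ℤ) : ℂ)) * (τ : ℂ) +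
        (((γ : Matrix (Fin 2) (Fin 2) ℤ) 1 1 : ℤ) : ℂ)) ^ (-(w : ℂ)) * f (γ • τ)

/-- The trivial character. -/
def trivChar : ℤ → ℤ := fun _ => 1

open scoped Classical in
/-- The multiple theta series `Θ_{m₁,…,m_k,Λ}` attached to a family of bases `B i`. -/
def thetaMulti (k : ℕ) (B : Fin k → Finset (Poly n)) (L : Submodule ℤ (E n))
    (μ : Measure (E n)) (τ : UpperHalfPlane) : ℂ :=
  ∑ g ∈ Fintype.piFinset B,
    (∏ i, theta n (g i) L τ) * (((∫ x, ∏ i, peval n (g i) x ∂μ) : ℝ) : ℂ)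

/-- The polynomial `p_m` (evaluated at `c`). -/
def pmVal (m : ℕ) (c : ℝ) : ℝ :=
  ∑ k ∈ Finset.range (m + 1),
    (-1 : ℝ) ^ k * c ^ (2 * m - 2 * k) /
      ((Nat.factorial (2 * m - 2 * k) : ℝ) * (Nat.factorial k : ℝ) * 2 ^ k *
        ∏ l ∈ Finset.range k, ((n : ℝ) + 4 * m - 4 - 2 * l))

/-- The heat flux `f_Λ` of the lattice `L`. -/
def heatF (L : Submodule ℤ (E n)) (t : ℝ) (x : E n) : ℝ :=
  (4 * Real.pi * t) ^ (-(n : ℝ) / 2) * ∑' γ : L, Real.exp (-‖x - (γ : E n)‖ ^ 2 / (4 * t))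

/-- Partial derivative of a function on Euclidean space. -/
def pdFun (i : Fin n) (F : E n → ℝ) : E n → ℝ := fun x => fderiv ℝ F x (EuclideanSpace.single i 1)

/-- Iterated partial derivative `∂^I` of a function on Euclidean space. -/
def pdIFun (I : Fin n →₀ ℕ) : (E n → ℝ) → (E n → ℝ) :=
  (List.ofFn fun i : Fin n => (fun F : E n → ℝ => (pdFun n i)^[I i] F)).foldr (· ∘ ·) id

/-- The differential operator `g(∂)` applied to a smooth function. -/
def applyDiff (g : Poly n) (F : E n → ℝ) (x : E n) : ℝ :=
  ∑ I ∈ g.support, g.coeff I * pdIFun n I F x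

open scoped Classical in
/-- The degree `2m` homogeneous term of the Taylor expansion of `x ↦ f_Λ(t,x)` at `0`. -/
def taylorTerm (L : Submodule ℤ (E n)) (m : ℕ) (t : ℝ) : Poly n :=
  ∑ c ∈ (Fintype.piFinset fun _ : Fin n => Finset.range (2 * m + 1)).filter
      (fun c => ∑ i, c i = 2 * m),
    (pdIFun n (Finsupp.equivFunOnFinite.symm c) (heatF n L t) 0 /
      ∏ i, (Nat.factorial (c i) : ℝ)) • ∏ i, X i ^ c i

/-- `P` is the orthogonal projection of `A_m` onto `Harm_m` w.r.t. the differential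
pairing: on `A_m` it takes values in `Harm_m`, `f - P f` is orthogonal to `Harm_m`,
and it is the identity on `Harm_m`. -/
def IsHarmProj (m : ℕ) (P : Poly n → Poly n) : Prop :=
  (∀ f ∈ homogeneousSubmodule (Fin n) ℝ m, P f ∈ Harm n m ∧
    ∀ h ∈ Harm n m, dPair n h (f - P f) = 0) ∧
  ∀ h ∈ Harm n m, P h = h

/-- The `E₈` lattice as a subset of `ℝ⁸`. -/
def E8set : Set (E 8) :=
  {x | ((∀ i, ∃ z : ℤ, x i = (z : ℝ)) ∨ (∀ i, ∃ z : ℤ, x i = (z : ℝ) + 1 / 2)) ∧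
    ∃ z : ℤ, (∑ i, x i) = 2 * (z : ℝ)}

end Heat

namespace Heat

variable (n : ℕ)

/-- The operator `P_{harm,m} = ∑_{k=0}^{⌊m/2⌋} r_{k,m} · r^{2k} Δ^k` on polynomials. -/
def PharmOp (m : ℕ) : Poly n → Poly n := fun f =>
  ∑ k ∈ Finset.range (m / 2 + 1),
    (1 / ((2 : ℝ) ^ k * (Nat.factorial k : ℝ) *
      ∏ l ∈ Finset.range k, ((n : ℝ) + 2 * (m : ℝ) - 4 - 2 * (l : ℝ)))) •
      (rsq n ^ k * ((lap n ^ k) f))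

/-- The quantity `Ξ(u,v,w)`. -/
def Xi (u v w : E n) : ℝ :=
  2 * ‖u‖ ^ 2 * ‖v‖ ^ 2 * ‖w‖ ^ 2 -
    (n : ℝ) * (‖u‖ ^ 2 * ⟪v, w⟫ ^ 2 + ‖v‖ ^ 2 * ⟪u, w⟫ ^ 2 + ‖w‖ ^ 2 * ⟪u, v⟫ ^ 2) +
    (n : ℝ) ^ 2 * ⟪v, w⟫ * ⟪u, w⟫ * ⟪u, v⟫

/-- The `k`-th coefficient of the claimed q-expansion of `Θ_{m,m,Λ}`. -/
def mmCoeff (m : ℕ) (L : Submodule ℤ (E n)) (k : ℕ) : ℝ :=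
  ∑' p : {p : L × L // (p.1 : E n) ≠ 0 ∧ (p.2 : E n) ≠ 0 ∧
      ‖(p.1 : E n)‖ ^ 2 + ‖(p.2 : E n)‖ ^ 2 = (k : ℝ)},
    pmVal n m (⟪(p.1.1 : E n), (p.1.2 : E n)⟫ / (‖(p.1.1 : E n)‖ * ‖(p.1.2 : E n)‖)) *
      ‖(p.1.1 : E n)‖ ^ (2 * m) * ‖(p.1.2 : E n)‖ ^ (2 * m)

/-- The sum `∑ Ξ(u,v,w)` over lattice triples of total square norm `k`. -/
def tripleCoeff (L : Submodule ℤ (E n)) (k : ℕ) : ℝ :=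
  ∑' t : {t : L × L × L //
      ‖(t.1 : E n)‖ ^ 2 + ‖(t.2.1 : E n)‖ ^ 2 + ‖(t.2.2 : E n)‖ ^ 2 = (k : ℝ)},
    Xi n (t.1.1 : E n) (t.1.2.1 : E n) (t.1.2.2 : E n)

/-- The generalized binomial coefficient `C(z,k) = z(z-1)⋯(z-k+1)/k!`. -/
def genBinom (z : ℝ) (k : ℕ) : ℝ :=
  (∏ a ∈ Finset.range k, (z - (a : ℝ))) / (Nat.factorial k : ℝ)

open scoped Classical in
/-- The monomial orthonormal basis `{xᵢ²/√2} ∪ {xᵢxⱼ, i<j}` of `A₂`. -/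
def B2 : Finset (Poly n) :=
  (Finset.univ.image fun i : Fin n => (Real.sqrt 2)⁻¹ • (X i ^ 2 : Poly n)) ∪
  ((Finset.univ.filter fun p : Fin n × Fin n => p.1 < p.2).image
    fun p => (X p.1 * X p.2 : Poly n))

/-- The explicit harmonic projection in degree two, `P = id + (1/(2n)) r² Δ`. -/
def P2 : Poly n → Poly n := fun g => g + (1 / (2 * (n : ℝ))) • (rsq n * lap n g)

end Heat
namespace Heat

/-! ### Part A: compositions of commuting operators -/

/-- Composition of iterates of commuting operators, along a list. -/
def compL {M : Type*} {n : ℕ} (f : Fin n → M → M) (I : Fin n →₀ ℕ) (l : List (Fin n)) : M → M :=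
  (l.map fun i => (fun p : M => (f i)^[I i] p)).foldr (· ∘ ·) id

lemma compL_cons {M : Type*} {n : ℕ} (f : Fin n → M → M) (I : Fin n →₀ ℕ) (j : Fin n)
    (l : List (Fin n)) (p : M) : compL f I (j :: l) p = (f j)^[I j] (compL f I l p) := rfl

lemma compL_comm {M : Type*} {n : ℕ} (f : Fin n → M → M) (hf : ∀ i j p, f i (f j p) = f j (f i p))
    (I : Fin n →₀ ℕ) (i : Fin n) (l : List (Fin n)) (p : M) :
    compL f I l (f i p) = f i (compL f I l p) := by
  induction l with
  | nil => rfl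
  | cons j l ih =>
    rw [compL_cons, compL_cons, ih]
    exact (Function.Commute.iterate_left (f := f j) (g := f i) (fun p => hf j i p) (I j)) _

lemma compL_notMem {M : Type*} {n : ℕ} (f : Fin n → M → M)
    (I : Fin n →₀ ℕ) (i : Fin n) (l : List (Fin n)) (hi : i ∉ l) (p : M) :
    compL f (I + Finsupp.single i 1) l p = compL f I l p := by
  induction l with
  | nil => rfl
  | cons j l ih =>
    simp only [List.mem_cons, not_or] at hi
    rw [compL_cons, compL_cons, ih hi.2]
    simp [Finsupp.single_apply, hi.1]

lemma compL_mem {M : Type*} {n : ℕ} (f : Fin n → M → M) (hf : ∀ i j p, f i (f j p) = f j (f i p))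
    (I : Fin n →₀ ℕ) (i : Fin n) (l : List (Fin n)) (hl : l.Nodup) (hi : i ∈ l) (p : M) :
    compL f (I + Finsupp.single i 1) l p = compL f I l (f i p) := by
  induction l with
  | nil => simp at hi
  | cons j l ih =>
    rw [List.nodup_cons] at hl
    rw [compL_cons, compL_cons]
    by_cases h : i = j
    · subst h
      rw [compL_notMem f I i l hl.1, compL_comm f hf]
      simp [Function.iterate_succ_apply]
    · have hi' : i ∈ l := by simpa [h] using hi
      rw [ih hl.2 hi']
      simp [Finsupp.single_apply, h]

/-- `pdI` and `pdIFun` in the common form. -/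
def compI {M : Type*} {n : ℕ} (f : Fin n → M → M) (I : Fin n →₀ ℕ) : M → M :=
  compL f I (List.finRange n)

lemma compI_add_single {M : Type*} {n : ℕ} (f : Fin n → M → M)
    (hf : ∀ i j p, f i (f j p) = f j (f i p))
    (I : Fin n →₀ ℕ) (i : Fin n) (p : M) :
    compI f (I + Finsupp.single i 1) p = compI f I (f i p) :=
  compL_mem f hf I i _ (List.nodup_finRange n) (List.mem_finRange i) p

lemma compI_zero {M : Type*} {n : ℕ} (f : Fin n → M → M) (p : M) : compI f 0 p = p := by
  unfold compI
  induction List.finRange n with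
  | nil => rfl
  | cons j l ih => rw [compL_cons, ih]; rfl

lemma pdI_eq (n : ℕ) (I : Fin n →₀ ℕ) (p : Poly n) :
    pdI n I p = compI (fun i => ⇑(pderiv (R := ℝ) i)) I p := by
  unfold pdI compI compL
  rw [List.ofFn_eq_map]

lemma pdIFun_eq (n : ℕ) (I : Fin n →₀ ℕ) (F : E n → ℝ) :
    pdIFun n I F = compI (pdFun n) I F := by
  unfold pdIFun compI compL
  rw [List.ofFn_eq_map]

lemma pderiv_comm' {σ : Type*} (i j : σ) (p : MvPolynomial σ ℝ) :
    pderiv i (pderiv j p) = pderiv j (pderiv i p) := by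
  classical
  ext m
  simp only [coeff_pderiv]
  by_cases h : i = j
  · subst h; rfl
  · rw [add_right_comm]
    simp [Finsupp.single_apply, h, Ne.symm h]
    ring

/-- Multi-index factorial. -/
def ifact {n : ℕ} (I : Fin n →₀ ℕ) : ℝ := ∏ i, (Nat.factorial (I i) : ℝ)

lemma ifact_ne {n : ℕ} (I : Fin n →₀ ℕ) : ifact I ≠ 0 := by
  unfold ifact
  exact Finset.prod_ne_zero_iff.mpr fun i _ => by exact_mod_cast Nat.factorial_ne_zero _

lemma ifact_pos {n : ℕ} (I : Fin n →₀ ℕ) : 0 < ifact I := by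
  unfold ifact
  exact Finset.prod_pos fun i _ => by exact_mod_cast Nat.factorial_pos _

lemma ifact_zero {n : ℕ} : ifact (0 : Fin n →₀ ℕ) = 1 := by simp [ifact]

lemma ifact_add_single {n : ℕ} (I : Fin n →₀ ℕ) (i : Fin n) :
    ifact (I + Finsupp.single i 1) = (I i + 1) * ifact I := by
  unfold ifact
  rw [← Finset.mul_prod_erase _ _ (Finset.mem_univ i),
    ← Finset.mul_prod_erase (a := i) (f := fun j => ((I j).factorial : ℝ)) _ (Finset.mem_univ i)]
  rw [← mul_assoc]
  congr 1
  · simp [Nat.factorial_succ]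
  · refine Finset.prod_congr rfl fun j hj => ?_
    simp [Finsupp.single_apply, (Finset.ne_of_mem_erase hj).symm]

lemma finsupp_ind {n : ℕ} {p : (Fin n →₀ ℕ) → Prop} (h0 : p 0)
    (h1 : ∀ I i, p I → p (I + Finsupp.single i 1)) (I : Fin n →₀ ℕ) : p I := by
  induction I using Finsupp.induction_linear with
  | zero => exact h0
  | add f g hf hg =>
    clear hf
    have key : ∀ g : Fin n →₀ ℕ, ∀ f, p f → p (f + g) := by
      intro g
      induction g using Finsupp.induction_linear with
      | zero => simp
      | add a b ha hb => intro f hf; rw [← add_assoc]; exact hb _ (ha _ hf)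
      | single i k =>
        induction k with
        | zero => simp
        | succ k ih =>
          intro f hf
          rw [Finsupp.single_add, ← add_assoc]
          exact h1 _ _ (ih _ hf)
    rw [← zero_add (f + g)]; exact key _ _ h0
  | single i k =>
    induction k with
    | zero => simpa using h0
    | succ k ih => rw [Finsupp.single_add]; exact h1 _ _ ih

lemma eval_pdI (n : ℕ) (I : Fin n →₀ ℕ) (f : Poly n) :
    eval 0 (pdI n I f) = ifact I * coeff I f := by
  rw [pdI_eq]
  induction I using finsupp_ind generalizing f with
  | h0 => rw [compI_zero, ifact_zero, one_mul, ← constantCoeff_eq]; simp [constantCoeff_eq, eval_zero]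
  | h1 I i ih =>
    rw [compI_add_single _ (fun i j p => pderiv_comm' i j p), ih, coeff_pderiv, ifact_add_single]
    ring

lemma dPair_eq (n : ℕ) (g f : Poly n) :
    dPair n g f = ∑ I ∈ g.support, coeff I g * (ifact I * coeff I f) := by
  unfold dPair
  simp only [map_sum, smul_eval, eval_pdI]


lemma dPair_eq_of_subset (n : ℕ) (g f : Poly n) (S : Finset (Fin n →₀ ℕ)) (hS : g.support ⊆ S) :
    dPair n g f = ∑ I ∈ S, coeff I g * (ifact I * coeff I f) := by
  rw [dPair_eq]
  refine Finset.sum_subset hS fun I _ hI => ?_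
  rw [notMem_support_iff.mp hI, zero_mul]

/-- bilinear version of the pairing -/
def dP (n : ℕ) : Poly n →ₗ[ℝ] Poly n →ₗ[ℝ] ℝ :=
  LinearMap.mk₂ ℝ (dPair n)
    (fun g g' f => by
      classical
      rw [dPair_eq_of_subset n (g + g') f (g.support ∪ g'.support) support_add,
        dPair_eq_of_subset n g f (g.support ∪ g'.support) Finset.subset_union_left,
        dPair_eq_of_subset n g' f (g.support ∪ g'.support) Finset.subset_union_right,
        ← Finset.sum_add_distrib]
      refine Finset.sum_congr rfl fun I _ => ?_
      rw [coeff_add]; ring)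
    (fun c g f => by
      rw [dPair_eq_of_subset n (c • g) f g.support support_smul, dPair_eq, smul_eq_mul,
        Finset.mul_sum]
      refine Finset.sum_congr rfl fun I _ => ?_
      rw [coeff_smul, smul_eq_mul]; ring)
    (fun g f f' => by
      rw [dPair_eq, dPair_eq, dPair_eq, ← Finset.sum_add_distrib]
      refine Finset.sum_congr rfl fun I _ => ?_
      rw [coeff_add]; ring)
    (fun c g f => by
      rw [dPair_eq, dPair_eq, smul_eq_mul, Finset.mul_sum]
      refine Finset.sum_congr rfl fun I _ => ?_
      rw [coeff_smul, smul_eq_mul]; ring)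

lemma dP_apply (n : ℕ) (g f : Poly n) : dP n g f = dPair n g f := rfl

lemma dP_monomial (n : ℕ) (I : Fin n →₀ ℕ) (a : ℝ) (f : Poly n) :
    dP n (monomial I a) f = a * (ifact I * coeff I f) := by
  classical
  rw [dP_apply, dPair_eq_of_subset n _ f {I} support_monomial_subset]
  simp

lemma dP_self_eq_zero (n : ℕ) (g : Poly n) (h : dP n g g = 0) : g = 0 := by
  rw [dP_apply, dPair_eq, Finset.sum_eq_zero_iff_of_nonneg] at h
  · ext I
    by_contra hI
    have h1 := h I (mem_support_iff.mpr hI)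
    have := ifact_ne I
    simp_all
  · intro I _
    have := (ifact_pos I).le
    have h2 := mul_nonneg this (mul_self_nonneg (coeff I g))
    linarith [h2, mul_left_comm (coeff I g) (ifact I) (coeff I g)]

lemma dP_X_mul (n : ℕ) (i : Fin n) (g f : Poly n) :
    dP n g (X i * f) = dP n (pderiv i g) f := by
  classical
  induction g using MvPolynomial.induction_on' with
  | add p q hp hq => simp [hp, hq]
  | monomial J a =>
    rw [pderiv_monomial, dP_monomial, dP_monomial, coeff_X_mul']
    by_cases h : i ∈ J.support
    · rw [if_pos h]
      have h1 : J = (J - Finsupp.single i 1) + Finsupp.single i 1 := by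
        ext j
        simp only [Finsupp.add_apply, Finsupp.tsub_apply, Finsupp.single_apply]
        split_ifs with hj
        · subst hj; have := Finsupp.mem_support_iff.mp h; omega
        · simp
      set K := J - Finsupp.single i 1 with hK
      rw [h1, ifact_add_single]
      simp; ring
    · rw [if_neg h]
      simp [Finsupp.notMem_support_iff.mp h]

lemma lap_apply (n : ℕ) (f : Poly n) : lap n f = -∑ i, pderiv i (pderiv i f) := by
  simp [lap]

lemma dP_rsq_mul (n : ℕ) (g f : Poly n) :
    dP n g (rsq n * f) = - dP n (lap n g) f := by
  rw [lap_apply, rsq, Finset.sum_mul]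
  simp only [map_sum, map_neg, LinearMap.neg_apply, neg_neg, LinearMap.sum_apply]
  refine Finset.sum_congr rfl fun i _ => ?_
  rw [pow_two, mul_assoc, dP_X_mul, dP_X_mul]

lemma lap_rsq_mul (n d : ℕ) (u : Poly n) (hu : u.IsHomogeneous d) :
    lap n (rsq n * u) = rsq n * lap n u - (2 * (n : ℝ) + 4 * d) • u := by
  classical
  have hr : ∀ i : Fin n, pderiv i (rsq n) = 2 * X i := by
    intro i
    simp only [rsq, map_sum, pderiv_pow, pderiv_X]
    rw [Finset.sum_eq_single i]
    · simp
    · intro j _ hj; simp [Pi.single_apply, hj]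
    · simp
  have h1 : ∀ i : Fin n, pderiv i (pderiv i (rsq n * u)) =
      rsq n * pderiv i (pderiv i u) + (2 : ℝ) • u + (4 : ℝ) • (X i * pderiv i u) := by
    intro i
    have h2 : pderiv i (2 : Poly n) = 0 := by
      have := (pderiv i : Derivation ℝ (Poly n) (Poly n)).map_natCast 2
      simpa using this
    simp only [pderiv_mul, hr, map_add, pderiv_X_self, h2]
    simp only [smul_eq_C_mul, map_ofNat]
    ring
  have h3 := hu.sum_X_mul_pderiv
  rw [lap_apply, lap_apply]
  simp only [h1, Finset.sum_add_distrib, ← Finset.smul_sum, ← Finset.mul_sum, h3]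
  simp only [Finset.sum_const, Finset.card_univ, Fintype.card_fin]
  simp only [smul_eq_C_mul, nsmul_eq_mul, map_add, map_mul, map_ofNat, map_natCast]
  ring

lemma rsq_homog (n : ℕ) : (rsq n).IsHomogeneous 2 := by
  unfold rsq
  refine IsHomogeneous.sum _ _ _ fun i _ => ?_
  simpa using (isHomogeneous_X ℝ i).pow 2

lemma rsq_pow_mul_homog (n k d e : ℕ) (u : Poly n) (hu : u.IsHomogeneous d) (he : d + 2 * k = e) :
    (rsq n ^ k * u).IsHomogeneous e := by
  have := ((rsq_homog n).pow k).mul hu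
  rwa [show 2 * k + d = e by omega] at this

lemma lap_homog (n d : ℕ) (u : Poly n) (hu : u.IsHomogeneous d) :
    (lap n u).IsHomogeneous (d - 2) := by
  rw [lap_apply]
  refine IsHomogeneous.neg ?_
  refine IsHomogeneous.sum _ _ _ fun i _ => ?_
  have := (hu.pderiv (i := i)).pderiv (i := i)
  rwa [show d - 1 - 1 = d - 2 by omega] at this

lemma lap_pow_homog (n d k : ℕ) (u : Poly n) (hu : u.IsHomogeneous d) :
    ((lap n ^ k) u).IsHomogeneous (d - 2 * k) := by
  induction k with
  | zero => simpa using hu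
  | succ k ih =>
    rw [pow_succ', Module.End.mul_apply]
    have := lap_homog n _ _ ih
    rwa [show d - 2 * k - 2 = d - 2 * (k + 1) by omega] at this

lemma lap_rsq_pow_mul (n d k : ℕ) (u : Poly n) (hu : u.IsHomogeneous d) :
    lap n (rsq n ^ (k + 1) * u) = rsq n ^ (k + 1) * lap n u -
      (2 * ((k : ℝ) + 1) * (n + 2 * k + 2 * d)) • (rsq n ^ k * u) := by
  induction k with
  | zero =>
    have := lap_rsq_mul n d u hu
    simp only [zero_add, pow_one, this, pow_zero, one_mul, Nat.cast_zero]
    congr 2; ring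
  | succ k ih =>
    have h1 := lap_rsq_mul n (d + 2 * (k + 1)) (rsq n ^ (k + 1) * u)
      (rsq_pow_mul_homog n (k + 1) d _ u hu rfl)
    rw [pow_succ' (rsq n) (k + 1), mul_assoc, h1, ih]
    simp only [smul_eq_C_mul]
    push_cast
    simp only [map_add, map_mul, map_ofNat, map_natCast, map_one]
    ring

/-- The coefficients `p_{k,2m}`. -/
def pk (n m k : ℕ) : ℝ := 1 / ((2 : ℝ) ^ k * (Nat.factorial k : ℝ) *
            ∏ l ∈ Finset.range k, ((n : ℝ) + 4 * (m : ℝ) - 4 - 2 * (l : ℝ)))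

lemma pk_succ (n m k : ℕ) (hn : 0 < n) (hk : k < m) :
    pk n m (k + 1) * (2 * ((k : ℝ) + 1) * (n + 4 * m - 4 - 2 * k)) = pk n m k := by
  unfold pk
  have hpos : ∀ l ∈ Finset.range (k + 1), ((n : ℝ) + 4 * (m : ℝ) - 4 - 2 * (l : ℝ)) ≠ 0 := by
    intro l hl
    have h1 : l + 1 ≤ m := by have := Finset.mem_range.mp hl; omega
    have h1' : (l : ℝ) + 1 ≤ m := by exact_mod_cast h1
    have h2 : (1 : ℝ) ≤ n := by exact_mod_cast hn
    have h3 : (1 : ℝ) ≤ m := by exact_mod_cast (by omega : 1 ≤ m)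
    apply ne_of_gt
    linarith
  have hk' := hpos k (by simp)
  have hprod : ∏ l ∈ Finset.range k, ((n : ℝ) + 4 * (m : ℝ) - 4 - 2 * (l : ℝ)) ≠ 0 :=
    Finset.prod_ne_zero_iff.mpr fun l hl => hpos l (by simp at hl ⊢; omega)
  rw [Finset.prod_range_succ, Nat.factorial_succ]
  have hf : (k.factorial : ℝ) ≠ 0 := by exact_mod_cast Nat.factorial_ne_zero k
  have hk1 : (k : ℝ) + 1 ≠ 0 := by positivity
  push_cast
  generalize (n : ℝ) + 4 * (m : ℝ) - 4 - 2 * (k : ℝ) = c at hk' ⊢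
  generalize ∏ l ∈ Finset.range k, ((n : ℝ) + 4 * (m : ℝ) - 4 - 2 * (l : ℝ)) = q at hprod ⊢
  field_simp
  ring

/-- The explicit projection. -/
def Qop (n m : ℕ) (T : Poly n) : Poly n :=
  ∑ k ∈ Finset.range (m + 1), pk n m k • (rsq n ^ k * (lap n ^ k) T)

lemma Qop_homog (n m : ℕ) (T : Poly n) (hT : T.IsHomogeneous (2 * m)) :
    (Qop n m T).IsHomogeneous (2 * m) := by
  unfold Qop
  refine IsHomogeneous.sum _ _ _ fun k hk => ?_
  have hk' : k ≤ m := by simp at hk; omega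
  rw [smul_eq_C_mul]
  refine IsHomogeneous.C_mul ?_ _
  exact rsq_pow_mul_homog n k _ _ _ (lap_pow_homog n _ k T hT) (by omega)

lemma Qop_lap (n m : ℕ) (hn : 0 < n) (T : Poly n) (hT : T.IsHomogeneous (2 * m)) :
    lap n (Qop n m T) = 0 := by
  have key : ∀ j, j ≤ m → lap n (∑ k ∈ Finset.range (j + 1), pk n m k • (rsq n ^ k * (lap n ^ k) T))
      = pk n m j • (rsq n ^ j * (lap n ^ (j + 1)) T) := by
    intro j
    induction j with
    | zero => simp
    | succ j ih =>
      intro hj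
      rw [Finset.sum_range_succ, map_add, ih (by omega), map_smul,
        lap_rsq_pow_mul n _ j _ (lap_pow_homog n _ (j + 1) T hT)]
      have hs := pk_succ n m j hn (by omega)
      have hc : ((2 * m - 2 * (j + 1) : ℕ) : ℝ) = 2 * m - 2 * (j + 1) := by
        rw [Nat.cast_sub (by omega)]; push_cast; ring
      rw [hc, smul_sub, smul_smul,
        show pk n m (j + 1) * (2 * ((j : ℝ) + 1) * (n + 2 * j + 2 * (2 * m - 2 * (j + 1)))) = pk n m j
          by rw [← hs]; ring, pow_succ' (lap n) (j + 1), Module.End.mul_apply]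
      abel
  unfold Qop
  rw [key m le_rfl]
  have h0 : (lap n ^ (m + 1)) T = 0 := by
    have h1 := lap_pow_homog n _ m T hT
    rw [Nat.sub_self] at h1
    have h2 := totalDegree_eq_zero_iff_eq_C.mp (Nat.le_zero.mp h1.totalDegree_le)
    rw [pow_succ', Module.End.mul_apply, h2, lap_apply]
    simp
  rw [h0]; simp

lemma Qop_orth (n m : ℕ) (T h : Poly n) (hh : lap n h = 0) : dP n h (T - Qop n m T) = 0 := by
  have : T - Qop n m T = rsq n * (-∑ k ∈ Finset.range m,
      pk n m (k + 1) • (rsq n ^ k * (lap n ^ (k + 1)) T)) := by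
    unfold Qop
    rw [Finset.sum_range_succ', mul_neg, Finset.mul_sum]
    have : ∀ k, pk n m (k + 1) • (rsq n ^ (k + 1) * (lap n ^ (k + 1)) T) =
      rsq n * pk n m (k + 1) • (rsq n ^ k * (lap n ^ (k + 1)) T) := by
      intro k; rw [mul_smul_comm, pow_succ', mul_assoc]
    simp only [this]
    simp [pk]
  rw [this, dP_rsq_mul, hh]; simp

lemma proj_eq (n m : ℕ) (hn : 0 < n) (P : Poly n → Poly n) (hP : IsHarmProj n (2 * m) P)
    (T : Poly n) (hT : T.IsHomogeneous (2 * m)) : P T = Qop n m T := by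
  obtain ⟨h1, h2⟩ := hP.1 T hT
  have hQ : Qop n m T ∈ Harm n (2 * m) := ⟨Qop_homog n m T hT, Qop_lap n m hn T hT⟩
  have hd : P T - Qop n m T ∈ Harm n (2 * m) := Submodule.sub_mem _ h1 hQ
  have h3 := h2 _ hd
  have h4 := Qop_orth n m T _ (show lap n (P T - Qop n m T) = 0 from hd.2)
  rw [← dP_apply] at h3
  refine sub_eq_zero.mp (dP_self_eq_zero n _ ?_)
  have : P T - Qop n m T = (T - Qop n m T) - (T - P T) := by abel
  calc dP n (P T - Qop n m T) (P T - Qop n m T)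
      = dP n (P T - Qop n m T) ((T - Qop n m T) - (T - P T)) := by congr 1
    _ = 0 := by rw [map_sub, h3, h4, sub_zero]

lemma onb_expand (n : ℕ) (S : Submodule ℝ (Poly n)) (B : Finset (Poly n)) (hB : IsONBasis n S B)
    (Q : Poly n) (hQ : Q ∈ S) : ∑ g ∈ B, dP n g Q • g = Q := by
  rw [← hB.span, Submodule.mem_span_finset] at hQ
  obtain ⟨a, -, rfl⟩ := hQ
  refine Finset.sum_congr rfl fun g hg => ?_
  rw [map_sum, Finset.sum_eq_single g]
  · rw [map_smul, dP_apply, hB.ortho g hg g hg]; simp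
  · intro h hh hne
    rw [map_smul, dP_apply, hB.ortho g hg h hh, if_neg hne.symm]; simp
  · exact fun h => absurd hg h

/-! ### Part B: jets of smooth functions -/

section Jets
open scoped ContDiff

/-- Smooth functions. -/
def Sm (n : ℕ) : Submodule ℝ (E n → ℝ) where
  carrier := {F | ContDiff ℝ ∞ F}
  add_mem' := fun {_ _} ha hb => by
    simp only [Set.mem_setOf_eq] at ha hb ⊢
    exact ha.add hb
  zero_mem' := by
    simp only [Set.mem_setOf_eq]
    exact contDiff_const
  smul_mem' := fun c _ hF => by
    simp only [Set.mem_setOf_eq] at hF ⊢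
    exact hF.const_smul c

lemma pdFun_smooth (n : ℕ) (i : Fin n) (F : E n → ℝ) (hF : ContDiff ℝ ∞ F) :
    ContDiff ℝ ∞ (pdFun n i F) := by
  have := (contDiff_infty_iff_fderiv.mp hF).2
  exact this.clm_apply contDiff_const

lemma smDiff {n : ℕ} (F : Sm n) : Differentiable ℝ (F : E n → ℝ) :=
  (contDiff_infty_iff_fderiv.mp F.2).1

/-- partial derivatives on smooth functions -/
def Dop (n : ℕ) (i : Fin n) : Sm n →ₗ[ℝ] Sm n where
  toFun F := ⟨pdFun n i F, pdFun_smooth n i F F.2⟩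
  map_add' F G := by
    ext x
    simp only [pdFun, Submodule.coe_add, Pi.add_apply]
    rw [fderiv_add (smDiff F x) (smDiff G x)]; rfl
  map_smul' c F := by
    ext x
    simp only [pdFun, Submodule.coe_smul, Pi.smul_apply, RingHom.id_apply]
    rw [fderiv_const_smul (smDiff F x)]; rfl

lemma Dop_comm (n : ℕ) (i j : Fin n) (F : Sm n) : Dop n i (Dop n j F) = Dop n j (Dop n i F) := by
  ext x
  have hs : IsSymmSndFDerivAt ℝ (F : E n → ℝ) x :=
    ContDiffAt.isSymmSndFDerivAt (n := 2) 
      (contDiff_infty.mp (show ContDiff ℝ ∞ (F : E n → ℝ) from F.2) 2).contDiffAt (by simp)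
  have hd := (contDiff_infty_iff_fderiv.mp (contDiff_infty_iff_fderiv.mp F.2).2).1 x
  have key : ∀ i j : Fin n, (Dop n i (Dop n j F) : E n → ℝ) x =
      fderiv ℝ (fderiv ℝ (F : E n → ℝ)) x (EuclideanSpace.single i 1)
        (EuclideanSpace.single j 1) := by
    intro i j
    change fderiv ℝ (fun y => fderiv ℝ (F : E n → ℝ) y (EuclideanSpace.single j 1)) x _ = _
    rw [fderiv_clm_apply hd (by fun_prop)]
    simp
  rw [key, key]
  exact hs _ _

/-- multiplication by a coordinate -/
def Mop (n : ℕ) (i : Fin n) : Sm n →ₗ[ℝ] Sm n where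
  toFun F := ⟨fun x => x i * (F : E n → ℝ) x, by
    have : ContDiff ℝ ∞ (fun x : E n => x i) := (EuclideanSpace.proj (𝕜 := ℝ) i).contDiff
    exact this.mul F.2⟩
  map_add' F G := by ext x; simp [mul_add]
  map_smul' c F := by ext x; simp; ring

lemma Dop_Mop (n : ℕ) (i j : Fin n) (F : Sm n) :
    Dop n j (Mop n i F) = Mop n i (Dop n j F) + (if i = j then F else 0) := by
  ext x
  change fderiv ℝ (fun y : E n => y i * (F : E n → ℝ) y) x _ = _
  have h1 : HasFDerivAt (fun y : E n => y i) (EuclideanSpace.proj (𝕜 := ℝ) i) x :=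
    (EuclideanSpace.proj (𝕜 := ℝ) i).hasFDerivAt
  rw [(show HasFDerivAt (fun y : E n => y i * (F : E n → ℝ) y) _ x from
    h1.mul (smDiff F x).hasFDerivAt).fderiv]
  by_cases h : i = j
  · subst h
    simp [Mop, Dop, pdFun]
  · simp [Mop, Dop, pdFun, h]

/-- the derivatives at the origin -/
def Jet {n : ℕ} (F : Sm n) (I : Fin n →₀ ℕ) : ℝ :=
  ((compI (fun i => ⇑(Dop n i)) I F : Sm n) : E n → ℝ) 0

lemma compI_coe (n : ℕ) (I : Fin n →₀ ℕ) (F : Sm n) :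
    ((compI (fun i => ⇑(Dop n i)) I F : Sm n) : E n → ℝ) = pdIFun n I F := by
  rw [pdIFun_eq]
  unfold compI
  induction List.finRange n with
  | nil => rfl
  | cons j l ih =>
    rw [compL_cons, compL_cons, ← ih]
    generalize compL (fun i => ⇑(Dop n i)) I l F = G
    have : ∀ k : ℕ, ∀ G : Sm n, (((⇑(Dop n j))^[k] G : Sm n) : E n → ℝ) = (pdFun n j)^[k] G := by
      intro k
      induction k with
      | zero => intro G; rfl
      | succ k ih => intro G; rw [Function.iterate_succ_apply, Function.iterate_succ_apply, ih]; rfl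
    exact this _ _

lemma Jet_eq (n : ℕ) (I : Fin n →₀ ℕ) (F : Sm n) : Jet F I = pdIFun n I F 0 := by
  rw [← compI_coe]; rfl

lemma Jet_zero {n : ℕ} (F : Sm n) : Jet F 0 = (F : E n → ℝ) 0 := by
  unfold Jet; rw [compI_zero]

lemma Jet_succ {n : ℕ} (F : Sm n) (I : Fin n →₀ ℕ) (i : Fin n) :
    Jet F (I + Finsupp.single i 1) = Jet (Dop n i F) I := by
  unfold Jet
  rw [compI_add_single _ (fun i j p => Dop_comm n i j p)]

lemma Jet_add {n : ℕ} (F G : Sm n) (I : Fin n →₀ ℕ) : Jet (F + G) I = Jet F I + Jet G I := by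
  induction I using finsupp_ind generalizing F G with
  | h0 => simp [Jet_zero]
  | h1 I i ih => rw [Jet_succ, Jet_succ, Jet_succ, map_add, ih]

lemma Jet_smul {n : ℕ} (c : ℝ) (F : Sm n) (I : Fin n →₀ ℕ) : Jet (c • F) I = c * Jet F I := by
  induction I using finsupp_ind generalizing F with
  | h0 => simp [Jet_zero]
  | h1 I i ih => rw [Jet_succ, Jet_succ, map_smul, ih]

lemma Jet_Mop {n : ℕ} (i : Fin n) (F : Sm n) (I : Fin n →₀ ℕ) :
    Jet (Mop n i F) I = I i * Jet F (I - Finsupp.single i 1) := by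
  induction I using finsupp_ind generalizing F with
  | h0 => simp [Jet_zero, Mop]
  | h1 I j ih =>
    rw [Jet_succ, Dop_Mop, Jet_add, ih, ← Jet_succ]
    by_cases h : i = j
    · subst h
      have e1 : I + Finsupp.single i 1 - Finsupp.single i 1 = I := by simp
      rw [if_pos rfl, e1]
      by_cases h0 : I i = 0
      · simp [h0]
      · have e2 : I - Finsupp.single i 1 + Finsupp.single i 1 = I := by
          ext j
          simp only [Finsupp.add_apply, Finsupp.tsub_apply, Finsupp.single_apply]
          split_ifs with hj
          · subst hj; omega
          · simp
        rw [e2]; simp; ring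
    · have e3 : I + Finsupp.single j 1 - Finsupp.single i 1 =
          I - Finsupp.single i 1 + Finsupp.single j 1 := by
        ext l
        simp only [Finsupp.add_apply, Finsupp.tsub_apply, Finsupp.single_apply]
        split_ifs <;> omega
      have e4 : Jet (0 : Sm n) I = 0 := by simpa using Jet_smul (0 : ℝ) (0 : Sm n) I
      rw [if_neg h, e3, e4]
      simp [Ne.symm h]

open scoped Classical in
/-- polynomial with prescribed derivatives at `0` in degree `d` -/
def Tp (n d : ℕ) (a : (Fin n →₀ ℕ) → ℝ) : Poly n :=
  ∑ c ∈ (Fintype.piFinset fun _ : Fin n => Finset.range (d + 1)).filter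
      (fun c => ∑ i, c i = d),
    (a (Finsupp.equivFunOnFinite.symm c) /
      ∏ i, (Nat.factorial (c i) : ℝ)) • ∏ i, X i ^ c i

lemma coeff_Tp (n d : ℕ) (a : (Fin n →₀ ℕ) → ℝ) (I : Fin n →₀ ℕ) :
    coeff I (Tp n d a) = if ∑ i, I i = d then a I / ifact I else 0 := by
  classical
  have hmon : ∀ c : Fin n → ℕ, (∏ i, X i ^ c i : Poly n) =
      monomial (Finsupp.equivFunOnFinite.symm c) 1 := by
    intro c
    rw [monomial_eq, Finsupp.prod_fintype _ _ (by simp)]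
    simp
  unfold Tp
  rw [coeff_sum]
  simp only [hmon, coeff_smul, coeff_monomial, smul_eq_mul]
  have hiff : ∀ c : Fin n → ℕ, Finsupp.equivFunOnFinite.symm c = I ↔ c = ⇑I := by
    intro c
    rw [Equiv.symm_apply_eq]; rfl
  simp only [hiff, mul_ite, mul_one, mul_zero]
  rw [Finset.sum_ite_eq' _ (⇑I)]
  have hmem : (⇑I ∈ (Fintype.piFinset fun _ : Fin n => Finset.range (d + 1)).filter
      (fun c => ∑ i, c i = d)) ↔ ∑ i, I i = d := by
    simp only [Finset.mem_filter, Fintype.mem_piFinset, Finset.mem_range, and_iff_right_iff_imp]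
    intro h i
    have := Finset.single_le_sum (f := fun i => I i) (fun _ _ => Nat.zero_le _) (Finset.mem_univ i)
    omega
  have hsy : Finsupp.equivFunOnFinite.symm ⇑I = I := (hiff _).mpr rfl
  simp only [hmem, hsy]
  rfl

lemma sum_add_single {n : ℕ} (I : Fin n →₀ ℕ) (i : Fin n) :
    ∑ j, (I + Finsupp.single i 1 : Fin n →₀ ℕ) j = ∑ j, I j + 1 := by
  simp [Finset.sum_add_distrib, Finsupp.single_apply]

lemma Tp_homog (n d : ℕ) (a : (Fin n →₀ ℕ) → ℝ) : (Tp n d a).IsHomogeneous d := by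
  intro I hI
  rw [coeff_Tp] at hI
  by_cases h : ∑ i, I i = d
  · rw [← h, Finsupp.weight_apply, Finsupp.sum_fintype _ _ (by simp)]; simp
  · rw [if_neg h] at hI; exact absurd rfl hI

/-- Taylor term of a smooth function -/
def TF (n d : ℕ) : Sm n →ₗ[ℝ] Poly n where
  toFun F := Tp n d (Jet F)
  map_add' F G := by
    ext I; simp only [coeff_Tp, coeff_add, Jet_add]; split_ifs <;> ring
  map_smul' c F := by
    ext I
    simp only [coeff_Tp, coeff_smul, Jet_smul, RingHom.id_apply, smul_eq_mul]
    split_ifs <;> ring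

lemma coeff_TF (n d : ℕ) (F : Sm n) (I : Fin n →₀ ℕ) :
    coeff I (TF n d F) = if ∑ i, I i = d then Jet F I / ifact I else 0 := coeff_Tp _ _ _ _

lemma pderiv_TF (n d : ℕ) (i : Fin n) (F : Sm n) :
    pderiv i (TF n (d + 1) F) = TF n d (Dop n i F) := by
  ext I
  rw [coeff_pderiv, coeff_TF, coeff_TF, sum_add_single, ifact_add_single, Jet_succ]
  have h1 : (I i : ℝ) + 1 ≠ 0 := by positivity
  have := ifact_ne I
  by_cases h : ∑ j, I j = d
  · rw [if_pos (by omega), if_pos h]; field_simp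
  · rw [if_neg (by omega), if_neg h]; simp

lemma X_mul_TF (n d : ℕ) (i : Fin n) (F : Sm n) :
    TF n (d + 1) (Mop n i F) = X i * TF n d F := by
  classical
  ext I
  rw [coeff_X_mul', coeff_TF, coeff_TF, Jet_Mop]
  by_cases h0 : I i = 0
  · have : i ∉ I.support := by simp [h0]
    rw [if_neg this]; simp [h0]
  · rw [if_pos (show i ∈ I.support by simpa using h0)]
    obtain ⟨K, rfl⟩ : ∃ K, I = K + Finsupp.single i 1 := by
      refine ⟨I - Finsupp.single i 1, ?_⟩
      ext j
      simp only [Finsupp.add_apply, Finsupp.tsub_apply, Finsupp.single_apply]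
      split_ifs with hj
      · subst hj; omega
      · simp
    rw [add_tsub_cancel_right, sum_add_single, ifact_add_single]
    have h1 : (K i : ℝ) + 1 ≠ 0 := by positivity
    have := ifact_ne K
    by_cases h : ∑ j, K j = d
    · rw [if_pos (by omega), if_pos h]; simp; field_simp
    · rw [if_neg (by omega), if_neg h]

/-- Laplacian (positive sign convention) on smooth functions -/
def Lop (n : ℕ) (F : Sm n) : Sm n := ∑ i, Dop n i (Dop n i F)

/-- multiplication by `r²` -/
def Rop (n : ℕ) (F : Sm n) : Sm n := ∑ i, Mop n i (Mop n i F)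

lemma lap_TF (n d : ℕ) (F : Sm n) : lap n (TF n (d + 2) F) = - TF n d (Lop n F) := by
  rw [lap_apply, Lop, map_sum]
  simp only [pderiv_TF n (d + 1), pderiv_TF n d]

lemma TF_Rop (n d : ℕ) (F : Sm n) : TF n (d + 2) (Rop n F) = rsq n * TF n d F := by
  rw [Rop, map_sum, rsq, Finset.sum_mul]
  refine Finset.sum_congr rfl fun i _ => ?_
  rw [X_mul_TF n (d + 1), X_mul_TF n d]; ring

lemma lap_pow_TF (n d k : ℕ) (F : Sm n) :
    (lap n ^ k) (TF n (d + 2 * k) F) = (-1 : ℝ) ^ k • TF n d ((Lop n)^[k] F) := by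
  induction k generalizing F with
  | zero => simp
  | succ k ih =>
    rw [pow_succ, Module.End.mul_apply, show d + 2 * (k + 1) = d + 2 * k + 2 by ring, lap_TF,
      map_neg, ih, Function.iterate_succ_apply, pow_succ]
    simp

lemma TF_Rop_pow (n d k : ℕ) (F : Sm n) :
    TF n (d + 2 * k) ((Rop n)^[k] F) = rsq n ^ k * TF n d F := by
  induction k generalizing d with
  | zero => simp
  | succ k ih =>
    rw [Function.iterate_succ_apply', show d + 2 * (k + 1) = d + 2 * k + 2 by ring, TF_Rop, ih,
      pow_succ', mul_assoc]

lemma Rop_coe (n k : ℕ) (F : Sm n) (x : E n) :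
    (((Rop n)^[k] F : Sm n) : E n → ℝ) x = ‖x‖ ^ (2 * k) * (F : E n → ℝ) x := by
  induction k with
  | zero => simp
  | succ k ih =>
    have h1 : ∀ G : Sm n, ((Rop n G : Sm n) : E n → ℝ) x = ‖x‖ ^ 2 * (G : E n → ℝ) x := by
      intro G
      rw [EuclideanSpace.norm_sq_eq, Finset.sum_mul]
      simp only [Rop, Submodule.coe_sum, Finset.sum_apply]
      refine Finset.sum_congr rfl fun i _ => ?_
      simp only [Mop, LinearMap.coe_mk, AddHom.coe_mk, Real.norm_eq_abs, sq_abs]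
      ring
    rw [Function.iterate_succ_apply', h1, ih]; ring

lemma applyDiff_eq (n d : ℕ) (g : Poly n) (hg : g.IsHomogeneous d) (F : Sm n) :
    applyDiff n g F 0 = dP n g (TF n d F) := by
  rw [dP_apply, dPair_eq, applyDiff]
  refine Finset.sum_congr rfl fun I hI => ?_
  rw [coeff_TF, if_pos, ← Jet_eq]
  · have := ifact_ne I; field_simp
  · have := hg (mem_support_iff.mp hI)
    rw [← this, Finsupp.weight_apply, Finsupp.sum_fintype _ _ (by simp)]; simp

/-- The algebraic conclusion, for a smooth function `F` and functions `G k = (∑ ∂ᵢ²)^k F`. -/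
lemma main_alg (n m : ℕ) (hn : 0 < n) (P : Poly n → Poly n) (hP : IsHarmProj n (2 * m) P)
    (B : Finset (Poly n)) (hB : IsONBasis n (homogeneousSubmodule (Fin n) ℝ (2 * m)) B)
    (F : Sm n) (G : ℕ → E n → ℝ) (hG : ∀ k, G k = ((Lop n)^[k] F : Sm n)) :
    P (Tp n (2 * m) (fun I => pdIFun n I F 0)) =
      ∑ g ∈ B, (∑ k ∈ Finset.range (m + 1), pk n m k * (-1 : ℝ) ^ k *
        applyDiff n g (fun x => ‖x‖ ^ (2 * k) * G k x) 0) • g := by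
  have e1 : Tp n (2 * m) (fun I => pdIFun n I F 0) = TF n (2 * m) F := by
    change _ = Tp n (2 * m) (Jet F)
    congr 1; funext I; rw [Jet_eq]
  have hT : (TF n (2 * m) F).IsHomogeneous (2 * m) := Tp_homog _ _ _
  rw [e1, proj_eq n m hn P hP _ hT, ← onb_expand n _ B hB (Qop n m (TF n (2 * m) F))
    (Qop_homog n m _ hT)]
  refine Finset.sum_congr rfl fun g hg => ?_
  congr 1
  rw [Qop, map_sum]
  refine Finset.sum_congr rfl fun k hk => ?_
  have hk' : k ≤ m := by simp at hk; omega
  have e2 : (fun x => ‖x‖ ^ (2 * k) * G k x) = ((Rop n)^[k] ((Lop n)^[k] F) : Sm n) := by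
    funext x; rw [Rop_coe, hG]
  rw [e2, applyDiff_eq n (2 * m) g (hB.mem g hg)]
  obtain ⟨d, hd⟩ : ∃ d, 2 * m = d + 2 * k := ⟨2 * m - 2 * k, by omega⟩
  rw [hd, lap_pow_TF, TF_Rop_pow, map_smul, mul_smul_comm, map_smul, smul_eq_mul, smul_eq_mul]
  ring

end Jets

/-! ### Part C: analysis of the heat function -/

/-- polynomials in `1/t` and the coordinates -/
abbrev W (n : ℕ) := MvPolynomial (Option (Fin n)) ℝ

/-- evaluation at `(1/s, y)` -/
def ev {n : ℕ} (p : W n) (s : ℝ) (y : E n) : ℝ :=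
  eval (fun o : Option (Fin n) => o.elim s⁻¹ (fun i => y i)) p

lemma ev_add {n : ℕ} (p q : W n) (s : ℝ) (y : E n) : ev (p + q) s y = ev p s y + ev q s y := by
  simp [ev]

lemma ev_sub {n : ℕ} (p q : W n) (s : ℝ) (y : E n) : ev (p - q) s y = ev p s y - ev q s y := by
  simp [ev]

lemma ev_neg {n : ℕ} (p : W n) (s : ℝ) (y : E n) : ev (-p) s y = - ev p s y := by
  simp [ev]

lemma ev_mul {n : ℕ} (p q : W n) (s : ℝ) (y : E n) : ev (p * q) s y = ev p s y * ev q s y := by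
  simp [ev]

lemma ev_C {n : ℕ} (c : ℝ) (s : ℝ) (y : E n) : ev (C c : W n) s y = c := by
  simp [ev]

lemma ev_none {n : ℕ} (s : ℝ) (y : E n) : ev (X none : W n) s y = s⁻¹ := by
  simp [ev]

lemma ev_some {n : ℕ} (i : Fin n) (s : ℝ) (y : E n) : ev (X (some i) : W n) s y = y i := by
  simp [ev]

lemma ev_pow {n : ℕ} (p : W n) (k : ℕ) (s : ℝ) (y : E n) : ev (p ^ k) s y = ev p s y ^ k := by
  simp [ev]

lemma ev_sum {n : ℕ} {ι : Type*} (S : Finset ι) (p : ι → W n) (s : ℝ) (y : E n) :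
    ev (∑ i ∈ S, p i) s y = ∑ i ∈ S, ev (p i) s y := by
  simp [ev]

lemma ev_hasFDerivAt {n : ℕ} (p : W n) (s : ℝ) (y : E n) :
    HasFDerivAt (ev p s)
      (∑ i, ev (pderiv (some i) p) s y • (EuclideanSpace.proj i : E n →L[ℝ] ℝ)) y := by
  classical
  induction p using MvPolynomial.induction_on with
  | C a =>
    have : ev (C a : W n) s = fun _ : E n => a := by funext y; exact ev_C a s y
    rw [this]
    simp only [pderiv_C]
    simpa [ev] using hasFDerivAt_const a y
  | add p q hp hq =>
    have : ev (p + q) s = fun y => ev p s y + ev q s y := by funext y; exact ev_add p q s y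
    rw [this]
    refine (hp.add hq).congr_fderiv ?_
    simp [ev_add, add_smul, Finset.sum_add_distrib]
  | mul_X p o hp =>
    have : ev (p * X o) s = fun y => ev p s y * ev (X o) s y := by funext y; exact ev_mul p _ s y
    rw [this]
    cases o with
    | none =>
      simp only [ev_none]
      refine (hp.mul_const s⁻¹).congr_fderiv ?_
      simp [pderiv_mul, ev_mul, ev_none, Finset.smul_sum, smul_smul, mul_comm, pderiv_X]
    | some j =>
      simp only [ev_some]
      have h1 : HasFDerivAt (fun y : E n => y j) (EuclideanSpace.proj (𝕜 := ℝ) j) y :=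
        (EuclideanSpace.proj (𝕜 := ℝ) j).hasFDerivAt
      refine (hp.mul h1).congr_fderiv ?_
      simp only [pderiv_mul, ev_add, ev_mul, ev_some, add_smul, Finset.sum_add_distrib,
        Finset.smul_sum, smul_smul]
      rw [add_comm]
      congr 1
      · refine Finset.sum_congr rfl fun i _ => ?_
        rw [mul_comm]
      · rw [Finset.sum_eq_single j]
        · simp [ev]
        · intro i _ hi
          rw [pderiv_X_of_ne (by simpa using hi.symm)]
          simp [ev]
        · simp

lemma ev_hasDerivAt {n : ℕ} (p : W n) (s : ℝ) (hs : s ≠ 0) (y : E n) :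
    HasDerivAt (fun s => ev p s y) (ev (-(X none ^ 2) * pderiv none p) s y) s := by
  classical
  induction p using MvPolynomial.induction_on with
  | C a =>
    simp only [ev_C, pderiv_C, mul_zero]
    simpa [ev] using hasDerivAt_const s a
  | add p q hp hq =>
    simp only [ev_add, map_add, mul_add]
    exact hp.add hq
  | mul_X p o hp =>
    simp only [ev_mul]
    cases o with
    | none =>
      simp only [ev_none]
      refine (hp.mul (hasDerivAt_inv hs)).congr_deriv ?_
      simp only [pderiv_mul, pderiv_X_self, ev_add, ev_mul, ev_none, ev_neg, ev_pow]
      have h1 : ev (1 : W n) s y = 1 := by simp [ev]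
      rw [h1, ← inv_pow]
      ring
    | some j =>
      simp only [ev_some]
      refine (hp.mul_const (y j)).congr_deriv ?_
      rw [pderiv_mul, pderiv_X_of_ne (by simp)]
      simp only [ev_add, ev_mul, ev_some, mul_zero, add_zero]
      ring

/-- Gaussian times polynomial -/
def Kf {n : ℕ} (p : W n) (s : ℝ) (y : E n) : ℝ := ev p s y * Real.exp (-‖y‖ ^ 2 / (4 * s))

/-- action of `∂ᵢ` on the polynomial factor -/
def Dx (n : ℕ) (i : Fin n) : W n →ₗ[ℝ] W n :=
  (pderiv (some i) : Derivation ℝ (W n) (W n)).toLinearMap -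
    LinearMap.mulLeft ℝ (C (1 / 2) * X none * X (some i))

/-- action of `∂ₜ` on the polynomial factor (without prefactor) -/
def Dt0 (n : ℕ) : W n →ₗ[ℝ] W n :=
  LinearMap.mulLeft ℝ (-(X none ^ 2)) ∘ₗ (pderiv none : Derivation ℝ (W n) (W n)).toLinearMap +
    LinearMap.mulLeft ℝ (C (1 / 4) * X none ^ 2 * ∑ i, X (some i) ^ 2)

/-- action of `∂ₜ` on the polynomial factor (with prefactor) -/
def Dt (n : ℕ) : W n →ₗ[ℝ] W n :=
  Dt0 n - LinearMap.mulLeft ℝ (C ((n : ℝ) / 2) * X none)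

lemma Dx_apply (n : ℕ) (i : Fin n) (p : W n) :
    Dx n i p = pderiv (some i) p - C (1 / 2) * X none * X (some i) * p := by
  simp [Dx, mul_assoc]

lemma Dt0_apply (n : ℕ) (p : W n) :
    Dt0 n p = -(X none ^ 2) * pderiv none p + C (1 / 4) * X none ^ 2 * (∑ i, X (some i) ^ 2) * p := by
  simp [Dt0, mul_assoc]

lemma Dt_apply (n : ℕ) (p : W n) :
    Dt n p = Dt0 n p - C ((n : ℝ) / 2) * X none * p := by
  simp [Dt, mul_assoc]

lemma Dt_Dx (n : ℕ) (i : Fin n) (p : W n) : Dt n (Dx n i p) = Dx n i (Dt n p) := by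
  classical
  have h1 : pderiv (some i) (∑ j : Fin n, X (some j) ^ 2 : W n) = 2 * X (some i) := by
    simp only [map_sum, pderiv_pow, pderiv_X]
    rw [Finset.sum_eq_single i]
    · simp
    · intro j _ hj; simp [Pi.single_apply, hj]
    · simp
  have h2 : pderiv (some i) (X none : W n) = 0 := pderiv_X_of_ne (by simp)
  have h3 : pderiv none (X (some i) : W n) = 0 := pderiv_X_of_ne (by simp)
  simp only [Dt_apply, Dt0_apply, Dx_apply, map_sub, map_add, pderiv_mul, map_neg, pderiv_pow,
    pderiv_C, h1, h2, h3, pderiv_X_self, pderiv_comm' none (some i) p]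
  generalize (∑ j : Fin n, X (some j) ^ 2 : W n) = R
  have hc : (C (1 / 4) : W n) = C (1 / 2) * C (1 / 2) := by rw [← C_mul]; norm_num
  have hc2 : (C (1 / 2) : W n) * 2 = 1 := by
    rw [← map_ofNat C 2, ← C_mul]; norm_num
  rw [hc]
  linear_combination (-(X none ^ 2 * X (some i) * p * C (1 / 2))) * hc2

/-- `∑ ∂ᵢ²` on the polynomial factor -/
def Lx (n : ℕ) (p : W n) : W n := ∑ i, Dx n i (Dx n i p)

lemma Dt_Lx (n : ℕ) (p : W n) : Dt n (Lx n p) = Lx n (Dt n p) := by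
  simp only [Lx, map_sum, Dt_Dx]

lemma Dt_one (n : ℕ) : Dt n 1 = Lx n 1 := by
  classical
  have h2 : ∀ i : Fin n, pderiv (some i) (X none : W n) = 0 := fun i => pderiv_X_of_ne (by simp)
  have h3 : ∀ i : Fin n, Dx n i (Dx n i 1) =
      C (1 / 4) * X none ^ 2 * X (some i) ^ 2 - C (1 / 2) * X none := by
    intro i
    have hc : (C (1 / 4) : W n) = C (1 / 2) * C (1 / 2) := by rw [← C_mul]; norm_num
    simp only [Dx_apply, pderiv_one, map_sub, pderiv_mul, pderiv_C, h2, pderiv_X_self, hc,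
      map_zero]
    ring
  simp only [Lx, h3, Dt_apply, Dt0_apply, pderiv_one, Finset.sum_sub_distrib, ← Finset.mul_sum,
    Finset.sum_const, Finset.card_univ, Fintype.card_fin, nsmul_eq_mul]
  have hc : (C ((n : ℝ) / 2) : W n) = (n : W n) * C (1 / 2) := by
    rw [← map_natCast C n, ← C_mul]; congr 1; ring
  rw [hc]; ring

lemma Dt_iter (n k : ℕ) : (Dt n)^[k] 1 = (Lx n)^[k] 1 := by
  induction k with
  | zero => rfl
  | succ k ih =>
    rw [Function.iterate_succ_apply', ih, Function.iterate_succ_apply, ← Dt_one]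
    exact (Function.Commute.iterate_right (f := Dt n) (g := Lx n) (fun p => Dt_Lx n p) k) 1

lemma Kf_hasFDerivAt {n : ℕ} (p : W n) (s : ℝ) (y : E n) :
    HasFDerivAt (Kf p s) (∑ i, Kf (Dx n i p) s y • (EuclideanSpace.proj i : E n →L[ℝ] ℝ)) y := by
  have h1 : HasFDerivAt (fun y : E n => -‖y‖ ^ 2 / (4 * s))
      (∑ i, (-(1 / 2) * s⁻¹ * y i) • (EuclideanSpace.proj i : E n →L[ℝ] ℝ)) y := by
    have e : (fun y : E n => -‖y‖ ^ 2 / (4 * s)) = fun y : E n => ∑ i, (-(1 / 4) * s⁻¹) * (y i) ^ 2 := by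
      funext y
      rw [EuclideanSpace.norm_sq_eq, ← Finset.mul_sum]
      simp only [Real.norm_eq_abs, sq_abs]
      rw [div_eq_mul_inv, mul_inv]; ring
    rw [e]
    refine HasFDerivAt.fun_sum fun i _ => ?_
    have h1 : HasFDerivAt (fun y : E n => y i) (EuclideanSpace.proj (𝕜 := ℝ) i) y :=
      (EuclideanSpace.proj (𝕜 := ℝ) i).hasFDerivAt
    refine ((h1.pow 2).const_mul (-(1 / 4) * s⁻¹)).congr_fderiv ?_
    ext z; simp; ring
  refine ((ev_hasFDerivAt p s y).mul h1.exp).congr_fderiv ?_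
  simp only [Finset.smul_sum, smul_smul, ← Finset.sum_add_distrib, ← add_smul]
  refine Finset.sum_congr rfl fun i _ => ?_
  congr 1
  simp only [Kf, Dx_apply, ev_sub, ev_mul, ev_C, ev_none, ev_some]
  ring

lemma Kf_hasDerivAt {n : ℕ} (p : W n) (s : ℝ) (hs : s ≠ 0) (y : E n) :
    HasDerivAt (fun s => Kf p s y) (Kf (Dt0 n p) s y) s := by
  have h1 : HasDerivAt (fun s : ℝ => -‖y‖ ^ 2 / (4 * s)) (1 / 4 * (s⁻¹) ^ 2 * ‖y‖ ^ 2) s := by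
    have e : (fun s : ℝ => -‖y‖ ^ 2 / (4 * s)) = fun s : ℝ => (-‖y‖ ^ 2 / 4) * s⁻¹ := by
      funext s; rw [div_eq_mul_inv, mul_inv]; ring
    rw [e]
    refine ((hasDerivAt_inv hs).const_mul _).congr_deriv ?_
    rw [inv_pow]; ring
  refine ((ev_hasDerivAt p s hs y).mul h1.exp).congr_deriv ?_
  simp only [Kf, Dt0_apply, ev_add, ev_mul, ev_C, ev_none, ev_some, ev_pow, ev_sum]
  rw [EuclideanSpace.norm_sq_eq]
  simp only [Real.norm_eq_abs, sq_abs]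
  ring

lemma ev_bound {n : ℕ} (p : W n) (a : ℝ) (ha : 0 < a) :
    ∃ (c : ℝ) (N : ℕ), 0 ≤ c ∧ ∀ s, a ≤ s → ∀ y : E n, |ev p s y| ≤ c * (1 + ‖y‖) ^ N := by
  induction p using MvPolynomial.induction_on with
  | C r => exact ⟨|r|, 0, abs_nonneg r, fun s _ y => by simp [ev_C]⟩
  | add p q hp hq =>
    obtain ⟨c, N, hc, h⟩ := hp
    obtain ⟨c', N', hc', h'⟩ := hq
    refine ⟨c + c', N + N', add_nonneg hc hc', fun s hs y => ?_⟩
    have h1 : (1 : ℝ) ≤ 1 + ‖y‖ := by linarith [norm_nonneg y]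
    rw [ev_add]
    calc |ev p s y + ev q s y| ≤ |ev p s y| + |ev q s y| := abs_add_le _ _
      _ ≤ c * (1 + ‖y‖) ^ N + c' * (1 + ‖y‖) ^ N' := add_le_add (h s hs y) (h' s hs y)
      _ ≤ c * (1 + ‖y‖) ^ (N + N') + c' * (1 + ‖y‖) ^ (N + N') := by
        gcongr <;> first | exact h1 | omega
      _ = _ := by ring
  | mul_X p o hp =>
    obtain ⟨c, N, hc, h⟩ := hp
    cases o with
    | none =>
      refine ⟨c * a⁻¹, N, by positivity, fun s hs y => ?_⟩
      rw [ev_mul, ev_none, abs_mul, abs_of_pos (inv_pos.mpr (ha.trans_le hs))]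
      calc |ev p s y| * s⁻¹ ≤ (c * (1 + ‖y‖) ^ N) * a⁻¹ := by
            gcongr
            · exact (inv_pos.mpr (ha.trans_le hs)).le
            · exact h s hs y
        _ = _ := by ring
    | some i =>
      refine ⟨c, N + 1, hc, fun s hs y => ?_⟩
      rw [ev_mul, ev_some, abs_mul]
      have h1 : |y i| ≤ 1 + ‖y‖ := by
        have := PiLp.norm_apply_le y i
        rw [Real.norm_eq_abs] at this
        linarith
      calc |ev p s y| * |y i| ≤ (c * (1 + ‖y‖) ^ N) * (1 + ‖y‖) := by
            gcongr
            exact h s hs y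
        _ = _ := by ring

lemma Kf_bound {n : ℕ} (p : W n) (a b : ℝ) (ha : 0 < a) (M : ℕ) :
    ∃ c : ℝ, 0 ≤ c ∧ ∀ s, a ≤ s → s ≤ b → ∀ y : E n, |Kf p s y| * (1 + ‖y‖) ^ M ≤ c := by
  obtain ⟨c, N, hc, h⟩ := ev_bound p a ha
  refine ⟨c * ((N + M).factorial * Real.exp (1 + b)), by positivity, fun s hs hsb y => ?_⟩
  have hs0 : 0 < s := ha.trans_le hs
  have hy := norm_nonneg y
  have h1 : -‖y‖ ^ 2 / (4 * s) ≤ b - ‖y‖ := by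
    rw [div_le_iff₀ (by positivity)]
    nlinarith [sq_nonneg (‖y‖ - 2 * s)]
  have h2 : (1 + ‖y‖) ^ (N + M) ≤ (N + M).factorial * Real.exp (1 + ‖y‖) := by
    have := Real.pow_div_factorial_le_exp (1 + ‖y‖) (by positivity) (N + M)
    rw [div_le_iff₀ (by positivity)] at this
    linarith
  rw [Kf, abs_mul, Real.abs_exp]
  calc |ev p s y| * Real.exp (-‖y‖ ^ 2 / (4 * s)) * (1 + ‖y‖) ^ M
      ≤ (c * (1 + ‖y‖) ^ N) * Real.exp (b - ‖y‖) * (1 + ‖y‖) ^ M := by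
        gcongr
        exact h s hs y
    _ = c * ((1 + ‖y‖) ^ (N + M) * Real.exp (b - ‖y‖)) := by ring
    _ ≤ c * (((N + M).factorial * Real.exp (1 + ‖y‖)) * Real.exp (b - ‖y‖)) := by gcongr
    _ = _ := by rw [mul_assoc _ (Real.exp (1 + ‖y‖)), ← Real.exp_add]; ring_nf

lemma lattice_summable {n : ℕ} (L : Submodule ℤ (E n)) [DiscreteTopology L] :
    ∃ M : ℕ, Summable fun γ : L => ((1 + ‖(γ : E n)‖) ^ M)⁻¹ := by
  refine ⟨Module.finrank ℤ L + 1, ?_⟩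
  have h := ZLattice.summable_norm_pow_inv L (Module.finrank ℤ L + 1) (by omega)
  refine Summable.of_norm_bounded_eventually h ?_
  refine (Set.finite_singleton (0 : L)).subset fun γ hγ => ?_
  by_contra h0
  apply hγ
  have hpos : 0 < ‖(γ : E n)‖ := by
    rw [norm_pos_iff]
    intro h1; exact h0 (by simpa using h1)
  change ‖((1 + ‖(γ : E n)‖) ^ (Module.finrank ℤ L + 1))⁻¹‖ ≤ ‖γ‖⁻¹ ^ (Module.finrank ℤ L + 1)
  rw [Real.norm_eq_abs, abs_of_nonneg (by positivity), inv_pow]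
  have : ‖γ‖ = ‖(γ : E n)‖ := rfl
  rw [this]
  gcongr
  linarith

lemma Kf_lattice_bound {n : ℕ} (L : Submodule ℤ (E n)) [DiscreteTopology L] (p : W n)
    (a b R : ℝ) (ha : 0 < a) : ∃ u : L → ℝ, Summable u ∧
      ∀ γ : L, ∀ s, a ≤ s → s ≤ b → ∀ x : E n, ‖x‖ ≤ R → ‖Kf p s (x - γ)‖ ≤ u γ := by
  obtain ⟨M, hM⟩ := lattice_summable L
  obtain ⟨c, hc, h⟩ := Kf_bound p a b ha M
  refine ⟨fun γ => (c * (1 + R) ^ M) * ((1 + ‖(γ : E n)‖) ^ M)⁻¹, hM.mul_left _, ?_⟩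
  intro γ s hs hsb x hx
  have h1 := h s hs hsb (x - γ)
  have h2 : 1 + ‖(γ : E n)‖ ≤ (1 + ‖x - γ‖) * (1 + R) := by
    have h3 : ‖(γ : E n)‖ ≤ ‖x‖ + ‖x - γ‖ := by
      have := norm_sub_le x (x - γ)
      simpa using this
    have := mul_nonneg (norm_nonneg (x - γ)) ((norm_nonneg x).trans hx)
    nlinarith
  change ‖Kf p s (x - γ)‖ ≤ c * (1 + R) ^ M * ((1 + ‖(γ : E n)‖) ^ M)⁻¹
  rw [← div_eq_mul_inv, le_div_iff₀ (by positivity), Real.norm_eq_abs]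
  have hR : 0 ≤ R := (norm_nonneg x).trans hx
  calc |Kf p s (x - γ)| * (1 + ‖(γ : E n)‖) ^ M
      ≤ |Kf p s (x - γ)| * ((1 + ‖x - γ‖) * (1 + R)) ^ M := by gcongr
    _ = (|Kf p s (x - γ)| * (1 + ‖x - γ‖) ^ M) * (1 + R) ^ M := by rw [mul_pow]; ring
    _ ≤ _ := by gcongr

/-- lattice sums -/
def Sf {n : ℕ} (L : Submodule ℤ (E n)) (p : W n) (s : ℝ) (x : E n) : ℝ :=
  ∑' γ : L, Kf p s (x - γ)

lemma Kf_summable {n : ℕ} (L : Submodule ℤ (E n)) [DiscreteTopology L] (p : W n)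
    (s : ℝ) (hs : 0 < s) (x : E n) : Summable fun γ : L => Kf p s (x - γ) := by
  obtain ⟨u, hu, h⟩ := Kf_lattice_bound L p s s ‖x‖ hs
  exact Summable.of_norm_bounded hu fun γ => h γ s le_rfl le_rfl x le_rfl

lemma Sf_hasFDerivAt {n : ℕ} (L : Submodule ℤ (E n)) [DiscreteTopology L] (p : W n)
    (s : ℝ) (hs : 0 < s) (x : E n) :
    HasFDerivAt (Sf L p s) (∑ i, Sf L (Dx n i p) s x • (EuclideanSpace.proj i : E n →L[ℝ] ℝ)) x := by
  choose u hu h using fun i => Kf_lattice_bound L (Dx n i p) s s (‖x‖ + 1) hs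
  have key := hasFDerivAt_tsum_of_isPreconnected
    (u := fun γ : L => ∑ i, u i γ * ‖(EuclideanSpace.proj i : E n →L[ℝ] ℝ)‖)
    (f := fun (γ : L) (x : E n) => Kf p s (x - γ))
    (f' := fun (γ : L) (x : E n) =>
      ∑ i, Kf (Dx n i p) s (x - γ) • (EuclideanSpace.proj i : E n →L[ℝ] ℝ))
    (s := Metric.ball x 1) (x₀ := x) (x := x)
    (summable_sum fun i _ => (hu i).mul_right _) Metric.isOpen_ball
    (convex_ball x 1).isPreconnected ?_ ?_ (Metric.mem_ball_self one_pos)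
    (Kf_summable L p s hs x) (Metric.mem_ball_self one_pos)
  · refine key.congr_fderiv ?_
    rw [Summable.tsum_finsetSum]
    · refine Finset.sum_congr rfl fun i _ => ?_
      rw [Summable.tsum_smul_const (Kf_summable L _ s hs x)]
      rfl
    · intro i _
      exact (Kf_summable L _ s hs x).smul_const _
  · intro γ y _
    exact (hasFDerivAt_comp_sub (γ : E n)).mpr (Kf_hasFDerivAt p s (y - γ))
  · intro γ y hy
    refine (norm_sum_le _ _).trans (Finset.sum_le_sum fun i _ => ?_)
    rw [norm_smul]
    refine mul_le_mul_of_nonneg_right (h i γ s le_rfl le_rfl y ?_) (norm_nonneg _)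
    have := norm_sub_norm_le y x
    rw [Metric.mem_ball, dist_eq_norm] at hy
    linarith

lemma Sf_hasDerivAt {n : ℕ} (L : Submodule ℤ (E n)) [DiscreteTopology L] (p : W n)
    (s : ℝ) (hs : 0 < s) (x : E n) :
    HasDerivAt (fun s => Sf L p s x) (Sf L (Dt0 n p) s x) s := by
  obtain ⟨u, hu, h⟩ := Kf_lattice_bound L (Dt0 n p) (s / 2) (2 * s) ‖x‖ (by positivity)
  have hmem : s ∈ Set.Ioo (s / 2) (2 * s) := ⟨by linarith, by linarith⟩
  refine hasDerivAt_tsum_of_isPreconnected (u := u)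
    (g := fun (γ : L) s => Kf p s (x - γ))
    (g' := fun (γ : L) s => Kf (Dt0 n p) s (x - γ))
    (t := Set.Ioo (s / 2) (2 * s)) (y₀ := s) (y := s) hu isOpen_Ioo isPreconnected_Ioo ?_ ?_ hmem
    (Kf_summable L p s hs x) hmem
  · intro γ r hr
    exact Kf_hasDerivAt p r (by have := hr.1; intro h0; linarith) _
  · intro γ r hr
    exact h γ r hr.1.le hr.2.le x le_rfl

lemma Sf_add {n : ℕ} (L : Submodule ℤ (E n)) [DiscreteTopology L] (p q : W n)
    (s : ℝ) (hs : 0 < s) (x : E n) : Sf L (p + q) s x = Sf L p s x + Sf L q s x := by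
  unfold Sf
  rw [← (Kf_summable L p s hs x).tsum_add (Kf_summable L q s hs x)]
  simp only [Kf, ev_add, add_mul]

lemma Sf_mul {n : ℕ} (L : Submodule ℤ (E n)) (p : W n) (c s : ℝ) (x : E n) :
    Sf L (C c * X none * p) s x = c * s⁻¹ * Sf L p s x := by
  unfold Sf
  rw [← tsum_mul_left]
  simp only [Kf, ev_mul, ev_C, ev_none, mul_assoc]

lemma Sf_sub_mul {n : ℕ} (L : Submodule ℤ (E n)) [DiscreteTopology L] (p q : W n) (c : ℝ)
    (s : ℝ) (hs : 0 < s) (x : E n) :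
    Sf L (p - C c * X none * q) s x = Sf L p s x - c * s⁻¹ * Sf L q s x := by
  have : p - C c * X none * q = p + C (-c) * X none * q := by rw [C_neg]; ring
  rw [this, Sf_add L _ _ s hs, Sf_mul]; ring

/-- heat-type functions -/
def Gf {n : ℕ} (L : Submodule ℤ (E n)) (p : W n) (s : ℝ) (x : E n) : ℝ :=
  (4 * Real.pi * s) ^ (-(n : ℝ) / 2) * Sf L p s x

lemma heatF_eq {n : ℕ} (L : Submodule ℤ (E n)) : heatF n L = Gf L 1 := by
  funext s x
  simp only [heatF, Gf, Sf, Kf]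
  have : ∀ y : E n, ev (1 : W n) s y = 1 := by intro y; simp [ev]
  simp only [this, one_mul]

lemma Gf_hasFDerivAt {n : ℕ} (L : Submodule ℤ (E n)) [DiscreteTopology L] (p : W n)
    (s : ℝ) (hs : 0 < s) (x : E n) :
    HasFDerivAt (Gf L p s) (∑ i, Gf L (Dx n i p) s x • (EuclideanSpace.proj i : E n →L[ℝ] ℝ)) x := by
  refine ((Sf_hasFDerivAt L p s hs x).const_mul ((4 * Real.pi * s) ^ (-(n : ℝ) / 2))).congr_fderiv ?_
  simp only [Finset.smul_sum, smul_smul, Gf]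

lemma Gf_hasDerivAt {n : ℕ} (L : Submodule ℤ (E n)) [DiscreteTopology L] (p : W n)
    (s : ℝ) (hs : 0 < s) (x : E n) :
    HasDerivAt (fun s => Gf L p s x) (Gf L (Dt n p) s x) s := by
  have hpi := Real.pi_pos
  have h0 : 0 < 4 * Real.pi * s := by positivity
  have h1 : HasDerivAt (fun s : ℝ => (4 * Real.pi * s) ^ (-(n : ℝ) / 2))
      (-((n : ℝ) / 2) * s⁻¹ * (4 * Real.pi * s) ^ (-(n : ℝ) / 2)) s := by
    have h2 : HasDerivAt (fun s : ℝ => 4 * Real.pi * s) (4 * Real.pi) s := by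
      simpa using (hasDerivAt_id s).const_mul (4 * Real.pi)
    refine (h2.rpow_const (p := -(n : ℝ) / 2) (Or.inl h0.ne')).congr_deriv ?_
    rw [Real.rpow_sub_one h0.ne']
    field_simp
  refine (h1.mul (Sf_hasDerivAt L p s hs x)).congr_deriv ?_
  rw [Gf, Dt_apply, Sf_sub_mul L _ _ _ s hs]
  ring

lemma Gf_add {n : ℕ} (L : Submodule ℤ (E n)) [DiscreteTopology L] (p q : W n)
    (s : ℝ) (hs : 0 < s) (x : E n) : Gf L (p + q) s x = Gf L p s x + Gf L q s x := by
  rw [Gf, Sf_add L p q s hs, mul_add]; rfl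

lemma Gf_zero {n : ℕ} (L : Submodule ℤ (E n)) (s : ℝ) (x : E n) : Gf L 0 s x = 0 := by
  have : ∀ y : E n, ev (0 : W n) s y = 0 := by intro y; simp [ev]
  simp [Gf, Sf, Kf, this]

lemma Gf_deriv_iter {n : ℕ} (L : Submodule ℤ (E n)) [DiscreteTopology L] (p : W n) (x : E n)
    (k : ℕ) : ∀ s, 0 < s → deriv^[k] (fun s => Gf L p s x) s = Gf L ((Dt n)^[k] p) s x := by
  induction k with
  | zero => intro s _; rfl
  | succ k ih =>
    intro s hs
    rw [Function.iterate_succ_apply', Function.iterate_succ_apply',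
      ← (Gf_hasDerivAt L _ s hs x).deriv]
    refine Filter.EventuallyEq.deriv_eq ?_
    filter_upwards [lt_mem_nhds hs] with r hr using ih r hr

section smooth
open scoped ContDiff

lemma Gf_contDiff {n : ℕ} (L : Submodule ℤ (E n)) [DiscreteTopology L]
    (s : ℝ) (hs : 0 < s) (p : W n) : ContDiff ℝ ∞ (Gf L p s) := by
  rw [contDiff_infty]
  intro k
  induction k generalizing p with
  | zero =>
    have : Differentiable ℝ (Gf L p s) := fun x => (Gf_hasFDerivAt L p s hs x).differentiableAt
    exact contDiff_zero.mpr this.continuous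
  | succ k ih =>
    have hd : Differentiable ℝ (Gf L p s) := fun x => (Gf_hasFDerivAt L p s hs x).differentiableAt
    rw [Nat.cast_succ, contDiff_succ_iff_fderiv]
    refine ⟨hd, by simp, ?_⟩
    have : fderiv ℝ (Gf L p s) = fun x =>
        ∑ i, Gf L (Dx n i p) s x • (EuclideanSpace.proj i : E n →L[ℝ] ℝ) :=
      funext fun x => (Gf_hasFDerivAt L p s hs x).fderiv
    rw [this]
    exact ContDiff.sum fun i _ => (ih (Dx n i p)).smul contDiff_const

/-- bundled version -/
def GS {n : ℕ} (L : Submodule ℤ (E n)) [DiscreteTopology L]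
    (s : ℝ) (hs : 0 < s) (p : W n) : Sm n := ⟨Gf L p s, Gf_contDiff L s hs p⟩

lemma Dop_GS {n : ℕ} (L : Submodule ℤ (E n)) [DiscreteTopology L]
    (s : ℝ) (hs : 0 < s) (p : W n) (i : Fin n) : Dop n i (GS L s hs p) = GS L s hs (Dx n i p) := by
  ext x
  change fderiv ℝ (Gf L p s) x _ = Gf L (Dx n i p) s x
  rw [(Gf_hasFDerivAt L p s hs x).fderiv]
  simp [Finset.sum_apply]

lemma GS_sum {n : ℕ} (L : Submodule ℤ (E n)) [DiscreteTopology L]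
    (s : ℝ) (hs : 0 < s) {ι : Type*} (T : Finset ι) (p : ι → W n) :
    GS L s hs (∑ i ∈ T, p i) = ∑ i ∈ T, GS L s hs (p i) := by
  classical
  induction T using Finset.induction_on with
  | empty => ext x; simp [GS, Gf_zero]
  | insert i T hi ih =>
    rw [Finset.sum_insert hi, Finset.sum_insert hi, ← ih]
    ext x
    exact Gf_add L _ _ s hs x

lemma Lop_iter_GS {n : ℕ} (L : Submodule ℤ (E n)) [DiscreteTopology L]
    (s : ℝ) (hs : 0 < s) (p : W n) (k : ℕ) :
    (Lop n)^[k] (GS L s hs p) = GS L s hs ((Lx n)^[k] p) := by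
  induction k with
  | zero => rfl
  | succ k ih =>
    rw [Function.iterate_succ_apply', Function.iterate_succ_apply', ih, Lop, Lx, GS_sum]
    simp only [Dop_GS]

end smooth

lemma lattice_discrete {n : ℕ} (b : Fin n → E n) (hb : LinearIndependent ℝ b) :
    DiscreteTopology (latticeOf n b) := by
  let B := basisOfLinearIndependentOfCardEqFinrank' b hb (by simp)
  have hB : (B : Fin n → E n) = b := by simp [B]
  unfold latticeOf
  rw [← hB]
  infer_instance

/-- the harmonic Taylor coefficient of the heat flux `f_Λ` is given by
`∑_{g ∈ B} (∑_k p_{k,2m} (-1)^k (g(∂)(r^{2k} ∂ₜ^k f_Λ))(t,0)) g` for any orthonormal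
basis `B` of `A_{2m}`. -/
theorem statement3 (n m : ℕ) (hn : 0 < n)
    (b : Fin n → E n) (hb : LinearIndependent ℝ b)
    (L : Submodule ℤ (E n)) (hLb : L = latticeOf n b)
    (P : Poly n → Poly n) (hP : IsHarmProj n (2 * m) P)
    (B : Finset (Poly n)) (hB : IsONBasis n (homogeneousSubmodule (Fin n) ℝ (2 * m)) B)
    (t : ℝ) (ht : 0 < t) :
    P (taylorTerm n L m t) =
      ∑ g ∈ B,
        (∑ k ∈ Finset.range (m + 1),
          (1 / ((2 : ℝ) ^ k * (Nat.factorial k : ℝ) *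
            ∏ l ∈ Finset.range k, ((n : ℝ) + 4 * (m : ℝ) - 4 - 2 * (l : ℝ)))) *
            (-1 : ℝ) ^ k *
            applyDiff n g
              (fun x => ‖x‖ ^ (2 * k) * deriv^[k] (fun s => heatF n L s x) t) 0) • g := by
  have : DiscreteTopology L := by rw [hLb]; exact lattice_discrete b hb
  have h := main_alg n m hn P hP B hB (GS L t ht 1)
    (fun k x => deriv^[k] (fun s => heatF n L s x) t) (by
      intro k
      rw [Lop_iter_GS, ← Dt_iter]
      funext x
      simp only [heatF_eq]
      exact Gf_deriv_iter L 1 x k t ht)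
  have e : taylorTerm n L m t =
      Tp n (2 * m) (fun I => pdIFun n I (GS L t ht 1 : Sm n) 0) := by
    change _ = Tp n (2 * m) (fun I => pdIFun n I (Gf L 1 t) 0)
    rw [← heatF_eq]
    rfl
  rw [e]
  exact h

end Heat
end
end

section
/- Let n ≥ 1, let h₁,…,hₙ ∈ ℝ satisfy Σ_{i=1}^n h_i = 0, let b_{ij} ∈ ℝ for 1 ≤ i < j ≤ n, and set F := (1/(2n)) ( Σ_{i=1}^n h_i x_i² + 2n Σ_{1≤i<j≤n} b_{ij} x_i x_j ). Then n⁴(n+2)(n+4) · ∫_{S^{n−1}} F³ dμ̄ = Σ_{i=1}^n h_i³ + 3n² Σ_{1≤i<j≤n} (h_i + h_j) b_{ij}² + 6n³ Σ_{1≤i<j<k≤n} b_{ij} b_{ik} b_{jk}. -/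
noncomputable section

open MvPolynomial MeasureTheory Finset
open scoped RealInnerProductSpace Manifold

namespace Heat

theorem integ {n : ℕ} {μ : Measure (E n)} (hμ : IsSphereMeasure n μ) {f : E n → ℝ}
    (hf : Continuous f) : Integrable f μ := by
  have := hμ.prob
  have h1 : μ.restrict (Metric.sphere (0 : E n) 1) = μ :=
    Measure.restrict_eq_self_of_ae_mem (by
      rw [ae_iff]; exact hμ.supp)
  have h2 : IntegrableOn f (Metric.sphere (0 : E n) 1) μ :=
    hf.continuousOn.integrableOn_compact (isCompact_sphere _ _)
  rw [IntegrableOn, h1] at h2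
  exact h2

theorem int_inv {n : ℕ} {μ : Measure (E n)} (hμ : IsSphereMeasure n μ)
    (φ : E n ≃ₗᵢ[ℝ] E n) (f : E n → ℝ) : ∫ x, f (φ x) ∂μ = ∫ x, f x ∂μ := by
  have := integral_map_equiv (μ := μ) φ.toHomeomorph.toMeasurableEquiv f
  have h2 : Measure.map φ.toHomeomorph.toMeasurableEquiv μ = μ := hμ.inv φ
  rw [h2] at this
  exact this.symm

/-- Reflection in the hyperplane orthogonal to `eᵢ + t eⱼ`. -/
theorem exists_refl {n : ℕ} (i j : Fin n) (hij : i ≠ j) (t : ℝ) :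
    ∃ φ : E n ≃ₗᵢ[ℝ] E n, ∀ x,
      (φ x i = x i - 2 * (x i + t * x j) / (1 + t ^ 2)) ∧
      (φ x j = x j - 2 * (x i + t * x j) / (1 + t ^ 2) * t) ∧
      (∀ k, k ≠ i → k ≠ j → φ x k = x k) := by
  set w : E n := EuclideanSpace.single i 1 + t • EuclideanSpace.single j 1 with hw
  have hwi : w i = 1 := by simp [hw, hij]
  have hwj : w j = t := by simp [hw, hij.symm]
  have hwk : ∀ k, k ≠ i → k ≠ j → w k = 0 := by
    intro k h1 h2; simp [hw, h1, h2]
  have hin : ∀ x : E n, ⟪w, x⟫ = x i + t * x j := by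
    intro x
    simp [hw, inner_add_left, inner_smul_left, EuclideanSpace.inner_single_left]
  have hno : ‖w‖ ^ 2 = 1 + t ^ 2 := by
    rw [← real_inner_self_eq_norm_sq, hin, hwi, hwj]; ring
  refine ⟨(ℝ ∙ w)ᗮ.reflection, fun x => ?_⟩
  have hr : (ℝ ∙ w)ᗮ.reflection x = x - (2 * (x i + t * x j) / (1 + t ^ 2)) • w := by
    rw [Submodule.reflection_orthogonal_apply, Submodule.reflection_singleton_apply, hin]
    simp only [RCLike.ofReal_real_eq_id, id, hno]
    rw [neg_sub]
    congr 1
    rw [two_smul, ← add_smul]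
    congr 1
    ring
  rw [hr]
  refine ⟨by simp [hwi], by simp [hwj], fun k h1 h2 => by simp [hwk k h1 h2]⟩

theorem moment_swap {n : ℕ} {μ : Measure (E n)} (hμ : IsSphereMeasure n μ)
    (i j : Fin n) (hij : i ≠ j) (f : E n → ℝ) :
    ∃ φ : E n ≃ₗᵢ[ℝ] E n, (∀ x, φ x i = x j ∧ φ x j = x i ∧ ∀ k, k ≠ i → k ≠ j → φ x k = x k) ∧
    ∫ x, f (φ x) ∂μ = ∫ x, f x ∂μ := by
  obtain ⟨φ, h⟩ := exists_refl i j hij (-1)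
  refine ⟨φ, fun x => ⟨?_, ?_, (h x).2.2⟩, int_inv hμ φ f⟩
  · rw [(h x).1]; ring
  · rw [(h x).2.1]; ring

theorem moments {n : ℕ} {μ : Measure (E n)} (hμ : IsSphereMeasure n μ) (hn : 1 ≤ n) :
    ∃ c : ℝ, ∀ i j k, ∫ x, x i ^ 2 * x j ^ 2 * x k ^ 2 ∂μ =
      c * (1 + 2 * (if i = j then 1 else 0) + 2 * (if i = k then 1 else 0)
        + 2 * (if j = k then 1 else 0) + 8 * (if i = j ∧ j = k then 1 else 0)) := by
  have i0 : Fin n := ⟨0, hn⟩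
  have h6 : ∀ i, ∫ x, x i ^ 6 ∂μ = ∫ x, x i0 ^ 6 ∂μ := by
    intro i
    by_cases h : i = i0
    · rw [h]
    obtain ⟨φ, h1, h2⟩ := moment_swap hμ i i0 h (fun x => x i0 ^ 6)
    rw [← h2]; simp only [(h1 _).2.1]
  have h42s : ∀ i j, i ≠ j → ∫ x, x i ^ 4 * x j ^ 2 ∂μ = ∫ x, x i ^ 2 * x j ^ 4 ∂μ := by
    intro i j h
    obtain ⟨φ, h1, h2⟩ := moment_swap hμ i j h (fun x => x i ^ 4 * x j ^ 2)
    rw [← h2]; simp only [(h1 _).1, (h1 _).2.1]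
    congr 1; ext x; ring
  have h42 : ∀ i j, i ≠ j → ∫ x, x i ^ 4 * x j ^ 2 ∂μ = (∫ x, x i0 ^ 6 ∂μ) / 5 := by
    intro i j h
    obtain ⟨φ, hφ⟩ := exists_refl i j h 2
    obtain ⟨ψ, hψ⟩ := exists_refl i j h (-2)
    have e1 := int_inv hμ φ (fun x => x i ^ 6)
    have e2 := int_inv hμ ψ (fun x => x i ^ 6)
    have e3 : ∫ x, ((φ x i ^ 6 + ψ x i ^ 6) : ℝ) ∂μ =
        ∫ x, ((1458 / 15625) * x i ^ 6 + (8192 / 15625) * x j ^ 6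
          + (38880 / 15625) * (x i ^ 4 * x j ^ 2) + (69120 / 15625) * (x i ^ 2 * x j ^ 4)) ∂μ := by
      congr 1; ext x; rw [(hφ x).1, (hψ x).1]; ring
    rw [integral_add (integ hμ (by fun_prop)) (integ hμ (by fun_prop)),
      integral_add (integ hμ (by fun_prop)) (integ hμ (by fun_prop)),
      integral_add (integ hμ (by fun_prop)) (integ hμ (by fun_prop)),
      integral_add (integ hμ (by fun_prop)) (integ hμ (by fun_prop)),
      integral_const_mul, integral_const_mul, integral_const_mul, integral_const_mul,
      ← h42s i j h, e1, e2, h6 i, h6 j] at e3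
    linarith
  have h222 : ∀ i j k, i ≠ j → i ≠ k → j ≠ k →
      ∫ x, x i ^ 2 * x j ^ 2 * x k ^ 2 ∂μ = (∫ x, x i0 ^ 6 ∂μ) / 15 := by
    intro i j k h hik hjk
    obtain ⟨φ, hφ⟩ := exists_refl i j h 2
    obtain ⟨ψ, hψ⟩ := exists_refl i j h (-2)
    have e1 := int_inv hμ φ (fun x => x i ^ 4 * x k ^ 2)
    have e2 := int_inv hμ ψ (fun x => x i ^ 4 * x k ^ 2)
    have e3 : ∫ x, ((φ x i ^ 4 * φ x k ^ 2 + ψ x i ^ 4 * ψ x k ^ 2) : ℝ) ∂μ =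
        ∫ x, ((162 / 625) * (x i ^ 4 * x k ^ 2) + (512 / 625) * (x j ^ 4 * x k ^ 2)
          + (1728 / 625) * (x i ^ 2 * x j ^ 2 * x k ^ 2)) ∂μ := by
      congr 1; ext x
      rw [(hφ x).1, (hψ x).1, (hφ x).2.2 k hik.symm hjk.symm, (hψ x).2.2 k hik.symm hjk.symm]; ring
    rw [integral_add (integ hμ (by fun_prop)) (integ hμ (by fun_prop)),
      integral_add (integ hμ (by fun_prop)) (integ hμ (by fun_prop)),
      integral_add (integ hμ (by fun_prop)) (integ hμ (by fun_prop)),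
      integral_const_mul, integral_const_mul, integral_const_mul,
      e1, e2, h42 i k hik, h42 j k hjk] at e3
    linarith
  refine ⟨(∫ x, x i0 ^ 6 ∂μ) / 15, fun i j k => ?_⟩
  by_cases h1 : i = j
  · subst h1
    by_cases h2 : i = k
    · subst h2
      simp only [and_self, if_true]
      have : ∫ x, x i ^ 2 * x i ^ 2 * x i ^ 2 ∂μ = ∫ x, x i ^ 6 ∂μ := by
        congr 1; ext x; ring
      rw [this, h6]; ring
    · have : ∫ x, x i ^ 2 * x i ^ 2 * x k ^ 2 ∂μ = ∫ x, x i ^ 4 * x k ^ 2 ∂μ := by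
        congr 1; ext x; ring
      rw [this, h42 i k h2]; simp [h2]; ring
  · by_cases h2 : i = k
    · subst h2
      have : ∫ x, x i ^ 2 * x j ^ 2 * x i ^ 2 ∂μ = ∫ x, x i ^ 4 * x j ^ 2 ∂μ := by
        congr 1; ext x; ring
      rw [this, h42 i j h1]; simp [h1, Ne.symm h1]; ring
    · by_cases h3 : j = k
      · subst h3
        have : ∫ x, x i ^ 2 * x j ^ 2 * x j ^ 2 ∂μ = ∫ x, x j ^ 4 * x i ^ 2 ∂μ := by
          congr 1; ext x; ring
        rw [this, h42 j i (Ne.symm h1)]; simp [h1]; ring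
      · rw [h222 i j k h1 h2 h3]; simp [h1, h2, h3]

theorem cube_int {n : ℕ} {μ : Measure (E n)} (hμ : IsSphereMeasure n μ) (l : Fin n → ℝ)
    {c : ℝ} (hc : ∀ i j k, ∫ x, x i ^ 2 * x j ^ 2 * x k ^ 2 ∂μ =
      c * (1 + 2 * (if i = j then 1 else 0) + 2 * (if i = k then 1 else 0)
        + 2 * (if j = k then 1 else 0) + 8 * (if i = j ∧ j = k then 1 else 0))) :
    ∫ x, (∑ i, l i * x i ^ 2) ^ 3 ∂μ =
      c * ((∑ i, l i) ^ 3 + 6 * (∑ i, l i) * (∑ i, l i ^ 2) + 8 * ∑ i, l i ^ 3) := by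
  have e : ∀ x : E n, (∑ i, l i * x i ^ 2) ^ 3 =
      ∑ i, ∑ j, ∑ k, (l i * l j * l k) * (x i ^ 2 * x j ^ 2 * x k ^ 2) := by
    intro x
    rw [pow_succ, pow_two, Finset.sum_mul_sum, Finset.sum_mul]
    refine Finset.sum_congr rfl fun i _ => ?_
    rw [Finset.sum_mul_sum]
    refine Finset.sum_congr rfl fun j _ => Finset.sum_congr rfl fun k _ => ?_
    ring
  simp_rw [e]
  rw [integral_finsetSum _ (fun i _ => integ hμ (by fun_prop))]
  have e2 : ∀ i, ∫ x : E n, ∑ j, ∑ k, (l i * l j * l k) * (x i ^ 2 * x j ^ 2 * x k ^ 2) ∂μ =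
      ∑ j, ∑ k, (l i * l j * l k) * (c * (1 + 2 * (if i = j then 1 else 0) + 2 * (if i = k then 1 else 0)
        + 2 * (if j = k then 1 else 0) + 8 * (if i = j ∧ j = k then 1 else 0))) := by
    intro i
    rw [integral_finsetSum _ (fun i _ => integ hμ (by fun_prop))]
    refine Finset.sum_congr rfl fun j _ => ?_
    rw [integral_finsetSum _ (fun i _ => integ hμ (by fun_prop))]
    refine Finset.sum_congr rfl fun k _ => ?_
    rw [integral_const_mul, hc]
  simp_rw [e2]
  have s1 : (∑ i, l i) ^ 3 = ∑ i, ∑ j, ∑ k, l i * l j * l k := by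
    rw [pow_succ, pow_two, Finset.sum_mul_sum, Finset.sum_mul]
    refine Finset.sum_congr rfl fun i _ => ?_
    rw [Finset.sum_mul_sum]
  have s2 : (∑ i, l i) * (∑ i, l i ^ 2) = ∑ i, ∑ j, ∑ k, l i * l j * l k * (if i = j then 1 else 0) := by
    simp only [mul_ite, mul_one, mul_zero]
    rw [mul_comm, Finset.sum_mul_sum]
    refine Finset.sum_congr rfl fun i _ => ?_
    rw [Finset.sum_comm]; simp [pow_two]
  have s3 : (∑ i, l i) * (∑ i, l i ^ 2) = ∑ i, ∑ j, ∑ k, l i * l j * l k * (if i = k then 1 else 0) := by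
    rw [mul_comm, Finset.sum_mul_sum]
    refine Finset.sum_congr rfl fun i _ => Finset.sum_congr rfl fun j _ => ?_
    simp; ring
  have s4 : (∑ i, l i) * (∑ i, l i ^ 2) = ∑ i, ∑ j, ∑ k, l i * l j * l k * (if j = k then 1 else 0) := by
    rw [Finset.sum_mul_sum]
    refine Finset.sum_congr rfl fun i _ => Finset.sum_congr rfl fun j _ => ?_
    simp; ring
  have s5 : (∑ i, l i ^ 3) = ∑ i, ∑ j, ∑ k, l i * l j * l k * (if i = j ∧ j = k then 1 else 0) := by
    refine Finset.sum_congr rfl fun i _ => ?_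
    simp [ite_and]; ring
  have : c * ((∑ i, l i) ^ 3 + 6 * (∑ i, l i) * (∑ i, l i ^ 2) + 8 * ∑ i, l i ^ 3) =
     c * ((∑ i, l i) ^ 3 + 2 * ((∑ i, l i) * (∑ i, l i ^ 2)) + 2 * ((∑ i, l i) * (∑ i, l i ^ 2))
      + 2 * ((∑ i, l i) * (∑ i, l i ^ 2)) + 8 * ∑ i, l i ^ 3) := by ring
  rw [this]
  nth_rw 1 [s2]
  nth_rw 1 [s3]
  rw [s1, s4, s5]
  simp only [Finset.mul_sum, ← Finset.sum_add_distrib]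
  refine Finset.sum_congr rfl fun i _ => Finset.sum_congr rfl fun j _ =>
    Finset.sum_congr rfl fun k _ => ?_
  ring

theorem cube_int_zero {n : ℕ} {μ : Measure (E n)} (hμ : IsSphereMeasure n μ) (hn : 1 ≤ n)
    (l : Fin n → ℝ) (hl : ∑ i, l i = 0) :
    (n : ℝ) * (n + 2) * (n + 4) * ∫ x, (∑ i, l i * x i ^ 2) ^ 3 ∂μ = 8 * ∑ i, l i ^ 3 := by
  obtain ⟨c, hc⟩ := moments hμ hn
  rw [cube_int hμ l hc, hl]
  have h1 := cube_int hμ (fun _ => 1) hc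
  have h2 : ∫ x : E n, (∑ i : Fin n, (1 : ℝ) * x i ^ 2) ^ 3 ∂μ = 1 := by
    have := hμ.prob
    have : ∫ x : E n, (∑ i : Fin n, (1 : ℝ) * x i ^ 2) ^ 3 ∂μ = ∫ x : E n, (1 : ℝ) ∂μ := by
      apply integral_congr_ae
      have : ∀ᵐ x ∂μ, x ∈ Metric.sphere (0 : E n) 1 := by rw [ae_iff]; exact hμ.supp
      filter_upwards [this] with x hx
      have hx' : ‖x‖ = 1 := by simpa using hx
      have := EuclideanSpace.real_norm_sq_eq x
      simp only [one_mul]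
      rw [← this, hx']; norm_num
    rw [this]; simp
  rw [h2] at h1
  simp at h1
  linear_combination (-8 * ∑ i, l i ^ 3) * h1

/-- symmetric matrix version -/
theorem cube_sym {n : ℕ} {μ : Measure (E n)} (hμ : IsSphereMeasure n μ) (hn : 1 ≤ n)
    (A : Matrix (Fin n) (Fin n) ℝ) (hA : A.IsHermitian) (ht : A.trace = 0) :
    (n : ℝ) * (n + 2) * (n + 4) * ∫ x : E n, (∑ i, ∑ j, A i j * x i * x j) ^ 3 ∂μ =
      8 * (A * A * A).trace := by
  set l := hA.eigenvalues with hl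
  set v := hA.eigenvectorBasis with hv
  set U : Matrix (Fin n) (Fin n) ℝ := (hA.eigenvectorUnitary : Matrix (Fin n) (Fin n) ℝ) with hU
  have hsp : A = U * Matrix.diagonal l * star U := by
    have := hA.spectral_theorem
    rw [Unitary.conjStarAlgAut_apply] at this
    exact this
  have hUU : star U * U = 1 := Unitary.coe_star_mul_self hA.eigenvectorUnitary
  have hUe : ∀ i k, U i k = v k i := fun i k => hA.eigenvectorUnitary_apply i k
  have hent : ∀ i j, A i j = ∑ k, l k * (v k i * v k j) := by
    intro i j
    have := congrFun (congrFun hsp i) j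
    rw [this, Matrix.mul_apply]
    refine Finset.sum_congr rfl fun k _ => ?_
    rw [Matrix.mul_diagonal, Matrix.star_apply, hUe, hUe]
    simp only [star_trivial]
    ring
  have hq : ∀ x : E n, ∑ i, ∑ j, A i j * x i * x j = ∑ i, l i * (v.repr x i) ^ 2 := by
    intro x
    have hr : ∀ k, v.repr x k = ∑ i, v k i * x i := by
      intro k
      rw [OrthonormalBasis.repr_apply_apply, PiLp.inner_apply]
      refine Finset.sum_congr rfl fun i _ => ?_
      simp [mul_comm]
    simp_rw [hr, hent, pow_two, Finset.sum_mul_sum, Finset.mul_sum, Finset.sum_mul]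
    have c1 : ∀ f : Fin n → Fin n → Fin n → ℝ,
        ∑ i, ∑ j, ∑ k, f i j k = ∑ k, ∑ i, ∑ j, f i j k := by
      intro f
      rw [Finset.sum_comm' (s' := fun _ => Finset.univ) (t' := Finset.univ) (by simp)]
      conv_lhs => enter [2, j]; rw [Finset.sum_comm]
      rw [Finset.sum_comm]
      exact Finset.sum_congr rfl fun k _ => Finset.sum_comm
    rw [c1]
    refine Finset.sum_congr rfl fun k _ => Finset.sum_congr rfl fun i _ =>
      Finset.sum_congr rfl fun j _ => ?_
    ring
  have ht3 : (A * A * A).trace = ∑ i, l i ^ 3 := by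
    have : A * A * A = U * (Matrix.diagonal l * Matrix.diagonal l * Matrix.diagonal l) * star U := by
      rw [hsp]
      calc _ = U * Matrix.diagonal l * (star U * U) * Matrix.diagonal l * (star U * U)
            * Matrix.diagonal l * star U := by noncomm_ring
        _ = _ := by rw [hUU]; noncomm_ring
    rw [this, Matrix.trace_mul_comm, ← Matrix.mul_assoc, hUU, Matrix.one_mul,
      Matrix.diagonal_mul_diagonal, Matrix.diagonal_mul_diagonal, Matrix.trace_diagonal]
    refine Finset.sum_congr rfl fun i _ => ?_
    ring
  have ht1 : ∑ i, l i = 0 := by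
    rw [← ht, hA.trace_eq_sum_eigenvalues]; simp [l]
  simp_rw [hq]
  rw [int_inv hμ v.repr (fun x => (∑ i, l i * x i ^ 2) ^ 3), cube_int_zero hμ hn l ht1, ht3]

theorem sum2 {n : ℕ} (f : Fin n → Fin n → ℝ) :
    ∑ i, ∑ j, f i j = ∑ i, f i i + ∑ i, ∑ j ∈ Finset.Ioi i, (f i j + f j i) := by
  have h1 : ∀ i j, f i j = (if i = j then f i j else 0) + ((if i < j then f i j else 0)
      + (if j < i then f i j else 0)) := by
    intro i j
    rcases lt_trichotomy i j with h | h | h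
    · simp [h, h.ne, h.le]
    · simp [h]
    · simp [h, h.ne', h.le]
  have e : ∀ i (g : Fin n → ℝ), ∑ j ∈ Finset.Ioi i, g j = ∑ j, if i < j then g j else 0 := by
    intro i g
    rw [← Finset.sum_filter]; congr 1; ext; simp
  simp_rw [e]
  conv_lhs => enter [2, i, 2, j]; rw [h1]
  simp only [Finset.sum_add_distrib, ite_add_zero]
  congr 1
  · simp
  congr 1
  rw [Finset.sum_comm]

theorem sum3 {n : ℕ} (f : Fin n → Fin n → Fin n → ℝ) (h12 : ∀ i j k, f i j k = f j i k)
    (h23 : ∀ i j k, f i j k = f i k j) :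
    ∑ i, ∑ j, ∑ k, f i j k = ∑ i, f i i i + 3 * ∑ i, ∑ j ∈ Finset.Ioi i, (f i i j + f i j j)
      + 6 * ∑ i, ∑ j ∈ Finset.Ioi i, ∑ k ∈ Finset.Ioi j, f i j k := by
  have e : ∀ i (g : Fin n → ℝ), ∑ j ∈ Finset.Ioi i, g j = ∑ j, if i < j then g j else 0 := by
    intro i g
    rw [← Finset.sum_filter]; congr 1; ext; simp
  have e' : ∑ i, ∑ j ∈ Finset.Ioi i, ∑ k ∈ Finset.Ioi j, f i j k =
      ∑ i, ∑ j, ∑ k, if i < j ∧ j < k then f i j k else 0 := by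
    simp_rw [e, ite_and]
    refine Finset.sum_congr rfl fun i _ => Finset.sum_congr rfl fun j _ => ?_
    split_ifs <;> simp
  set g : Fin n → Fin n → Fin n → ℝ := fun i j k => if i < j ∧ j < k then f i j k else 0 with hg
  have hd : ∀ i j k, f i j k =
      (g i j k + g i k j + g j i k + g j k i + g k i j + g k j i)
      + (if i = j then f i j k else 0) + (if j = k then f i j k else 0)
      + (if i = k then f i j k else 0) - 2 * (if i = j then (if j = k then f i j k else 0) else 0) := by
    intro i j k
    have a1 : f i k j = f i j k := (h23 _ _ _).symm
    have a2 : f j i k = f i j k := (h12 _ _ _).symm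
    have a3 : f j k i = f i j k := by rw [h23, a2]
    have a4 : f k i j = f i j k := by rw [h12, a1]
    have a5 : f k j i = f i j k := by rw [h23, a4]
    simp only [hg, a1, a2, a3, a4, a5]
    rcases lt_trichotomy i j with h | h | h <;> rcases lt_trichotomy j k with h' | h' | h' <;>
      rcases lt_trichotomy i k with h'' | h'' | h'' <;>
      first
      | (exfalso; omega)
      | (simp [*, not_lt_of_gt, ne_of_lt, ne_of_gt]; done)
      | (subst_vars; simp [*, not_lt_of_gt, ne_of_lt, ne_of_gt]; try ring)
  have p1 : ∑ i, ∑ j, ∑ k, g i k j = ∑ i, ∑ j, ∑ k, g i j k :=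
    Finset.sum_congr rfl fun i _ => Finset.sum_comm
  have p2 : ∑ i, ∑ j, ∑ k, g j i k = ∑ i, ∑ j, ∑ k, g i j k := Finset.sum_comm
  have p3 : ∑ i, ∑ j, ∑ k, g j k i = ∑ i, ∑ j, ∑ k, g i j k := by
    rw [Finset.sum_comm]; exact p1
  have p4 : ∑ i, ∑ j, ∑ k, g k i j = ∑ i, ∑ j, ∑ k, g i j k := by
    rw [← p2]; exact Finset.sum_congr rfl fun i _ => Finset.sum_comm
  have p5 : ∑ i, ∑ j, ∑ k, g k j i = ∑ i, ∑ j, ∑ k, g i j k := by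
    rw [← p3]; exact Finset.sum_congr rfl fun i _ => Finset.sum_comm
  have d1 : ∑ i, ∑ j, ∑ k, (if i = j then f i j k else 0) = ∑ i, ∑ j, f i i j := by
    refine Finset.sum_congr rfl fun i _ => ?_
    rw [Finset.sum_comm]; simp
  have d2 : ∑ i, ∑ j, ∑ k, (if j = k then f i j k else 0) = ∑ i, ∑ j, f i i j := by
    rw [Finset.sum_comm]; 
    refine Finset.sum_congr rfl fun i _ => Finset.sum_congr rfl fun j _ => ?_
    simp [h12 j i i, h23 i j i]
  have d3 : ∑ i, ∑ j, ∑ k, (if i = k then f i j k else 0) = ∑ i, ∑ j, f i i j := by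
    refine Finset.sum_congr rfl fun i _ => Finset.sum_congr rfl fun j _ => ?_
    simp [h23 i j i]
  have d4 : ∑ i, ∑ j, ∑ k, (if i = j then (if j = k then f i j k else 0) else 0) = ∑ i, f i i i := by
    refine Finset.sum_congr rfl fun i _ => ?_
    rw [Finset.sum_comm]; simp
  conv_lhs => enter [2, i, 2, j, 2, k]; rw [hd]
  simp only [Finset.sum_add_distrib, Finset.sum_sub_distrib, ← Finset.mul_sum]
  rw [p1, p2, p3, p4, p5, d1, d2, d3, d4, e', sum2 (fun i j => f i i j)]
  have : ∑ i, ∑ j ∈ Finset.Ioi i, (f i i j + f j j i) = ∑ i, ∑ j ∈ Finset.Ioi i, (f i i j + f i j j) := by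
    refine Finset.sum_congr rfl fun i _ => Finset.sum_congr rfl fun j _ => ?_
    rw [h23 j j i, h12 j i j]
  simp only [Finset.sum_add_distrib] at this ⊢
  linarith

/-- the cubic spherical integral of
`F = (1/2n)(∑ hᵢxᵢ² + 2n ∑_{i<j} bᵢⱼxᵢxⱼ)` with `∑ hᵢ = 0`. -/
theorem statement8 (n : ℕ) (hn : 1 ≤ n)
    (μ : Measure (E n)) (hμ : IsSphereMeasure n μ)
    (h : Fin n → ℝ) (hsum : ∑ i, h i = 0)
    (b : Fin n → Fin n → ℝ) :
    (n : ℝ) ^ 4 * ((n : ℝ) + 2) * ((n : ℝ) + 4) *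
      ∫ x, ((1 / (2 * (n : ℝ))) * (∑ i, h i * (x i) ^ 2 +
        2 * (n : ℝ) * ∑ i, ∑ j ∈ Finset.Ioi i, b i j * x i * x j)) ^ 3 ∂μ =
    ∑ i, (h i) ^ 3 +
      3 * (n : ℝ) ^ 2 * ∑ i, ∑ j ∈ Finset.Ioi i, (h i + h j) * (b i j) ^ 2 +
      6 * (n : ℝ) ^ 3 *
        ∑ i, ∑ j ∈ Finset.Ioi i, ∑ l ∈ Finset.Ioi j, b i j * b i l * b j l := by
  have hn0 : (n : ℝ) ≠ 0 := by positivity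
  set A : Matrix (Fin n) (Fin n) ℝ := Matrix.of fun i j =>
    if i = j then h i / (2 * n) else if i < j then b i j / 2 else b j i / 2 with hAdef
  have hd : ∀ i, A i i = h i / (2 * n) := by intro i; simp [hAdef]
  have ho : ∀ i j, i < j → A i j = b i j / 2 := by
    intro i j hij; simp [hAdef, hij, hij.ne]
  have hs : ∀ i j, A i j = A j i := by
    intro i j
    rcases lt_trichotomy i j with hh | hh | hh
    · simp [hAdef, hh, hh.ne, hh.ne', hh.le, not_lt_of_gt hh]
    · rw [hh]
    · simp [hAdef, hh, hh.ne, hh.ne', hh.le, not_lt_of_gt hh]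
  have hA : A.IsHermitian := by
    ext i j; simp [hs i j]
  have ht : A.trace = 0 := by
    simp only [Matrix.trace, Matrix.diag, hd]
    rw [← Finset.sum_div, hsum, zero_div]
  have key := cube_sym hμ hn A hA ht
  have hF : ∀ x : E n, (1 / (2 * (n : ℝ))) * (∑ i, h i * (x i) ^ 2 +
        2 * (n : ℝ) * ∑ i, ∑ j ∈ Finset.Ioi i, b i j * x i * x j) =
        ∑ i, ∑ j, A i j * x i * x j := by
    intro x
    rw [sum2 (fun i j => A i j * x i * x j), mul_add, Finset.mul_sum]
    congr 1
    · refine Finset.sum_congr rfl fun i _ => ?_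
      rw [hd]; ring
    · rw [← mul_assoc, one_div_mul_cancel (by positivity), one_mul]
      refine Finset.sum_congr rfl fun i _ => Finset.sum_congr rfl fun j hj => ?_
      rw [hs j i, ho i j (by simpa using hj)]; ring
  have htr : (A * A * A).trace = ∑ i, ∑ j, ∑ k, A i j * A i k * A j k := by
    simp only [Matrix.trace, Matrix.diag, Matrix.mul_apply, Finset.sum_mul]
    refine Finset.sum_congr rfl fun i _ => Finset.sum_congr rfl fun j _ =>
      Finset.sum_congr rfl fun k _ => ?_
    rw [hs j i, hs k j]; ring
  rw [sum3 (fun i j k => A i j * A i k * A j k)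
    (by intro i j k; beta_reduce; rw [hs i j]; ring)
    (by intro i j k; beta_reduce; rw [hs j k]; ring)] at htr
  have t1 : ∑ i, A i i * A i i * A i i = (∑ i, h i ^ 3) / (8 * n ^ 3) := by
    rw [Finset.sum_div]
    refine Finset.sum_congr rfl fun i _ => ?_
    rw [hd]; field_simp; norm_num
  have t2 : ∑ i, ∑ j ∈ Finset.Ioi i, (A i i * A i j * A i j + A i j * A i j * A j j) =
      (∑ i, ∑ j ∈ Finset.Ioi i, (h i + h j) * (b i j) ^ 2) / (8 * n) := by
    simp_rw [Finset.sum_div]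
    refine Finset.sum_congr rfl fun i _ => Finset.sum_congr rfl fun j hj => ?_
    rw [hd, hd, ho i j (by simpa using hj)]; field_simp; ring
  have t3 : ∑ i, ∑ j ∈ Finset.Ioi i, ∑ k ∈ Finset.Ioi j, A i j * A i k * A j k =
      (∑ i, ∑ j ∈ Finset.Ioi i, ∑ l ∈ Finset.Ioi j, b i j * b i l * b j l) / 8 := by
    simp_rw [Finset.sum_div]
    refine Finset.sum_congr rfl fun i _ => Finset.sum_congr rfl fun j hj =>
      Finset.sum_congr rfl fun k hk => ?_
    have hj' : i < j := by simpa using hj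
    have hk' : j < k := by simpa using hk
    rw [ho i j hj', ho j k hk', ho i k (hj'.trans hk')]; ring
  rw [t1, t2, t3] at htr
  simp_rw [hF]
  rw [htr] at key
  have : (n : ℝ) ^ 4 * ((n : ℝ) + 2) * ((n : ℝ) + 4) *
      ∫ x : E n, (∑ i, ∑ j, A i j * x i * x j) ^ 3 ∂μ = n ^ 3 * ((n : ℝ) * (n + 2) * (n + 4) *
      ∫ x : E n, (∑ i, ∑ j, A i j * x i * x j) ^ 3 ∂μ) := by ring
  rw [this, key]
  field_simp

end Heat
end
end
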